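/- arXiv:1703.03307 — 4 statements merged into one kernel-verified Lean document; each statement's English description precedes it below -/
import Mathlib

section
/- Let I be a finite index set, let A^i_{j,k}, B^i_{j,k}, C^i_{j,k}, D^i be complex scalars indexed by I with A^i_{j,k} = A^i_{k,j} and C^i_{j,k} = C^i_{k,j}, let R = ℂ[ħ] be the polynomial ring in one variable ħ, and for each i ∈ I define the R-linear operator on the polynomial ring R[x_j : j ∈ I]: L_i := ħ∂_i − (1/2)Σ_{a,b} A^i_{a,b} x_a x_b − ħ Σ_{a,b} B^i_{a,b} x_a ∂_b − (ħ²/2) Σ_{a,b} C^i_{a,b} ∂_a ∂_b − ħ D^i, where ∂_j is the formal partial derivative with respect to x_j and x_a acts by multiplication. Then there exist complex scalars f^k_{i,j} such that [L_i, L_j] = ħ Σ_a f^a_{i,j} L_a for all i, j ∈ I if and only if the tensors (A,B,C,D) satisfy the relations (SymA), (BB-AC), (BC), (BA) and (D); moreover, in that case the scalars are necessarily f^k_{i,j} = B^i_{j,k} − B^j_{i,k}. -/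
section Relations

variable {I : Type*} [Fintype I]

/-- The **BB-AC** relation. -/
def RelBBAC (A B C : I → I → I → ℂ) : Prop :=
  ∀ i j k l, ∑ a, (B i j a * B a k l + B i k a * B j a l + C i l a * A j a k)
    = ∑ a, (B j i a * B a k l + B j k a * B i a l + C j l a * A i a k)

/-- The **BC** relation. -/
def RelBC (B C : I → I → I → ℂ) : Prop :=
  ∀ i j k l, ∑ a, (B i j a * C a k l + C i k a * B j a l + C i l a * B j a k)
    = ∑ a, (B j i a * C a k l + C j k a * B i a l + C j l a * B i a k)

/-- The **BA** relation. -/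
def RelBA (A B : I → I → I → ℂ) : Prop :=
  ∀ i j k l, ∑ a, (B i j a * A a k l + B i k a * A j a l + B i l a * A j a k)
    = ∑ a, (B j i a * A a k l + B j k a * A i a l + B j l a * A i a k)

/-- The **D** relation. -/
def RelD (A B C : I → I → I → ℂ) (D : I → ℂ) : Prop :=
  ∀ i j, (∑ a, B i j a * D a) + (1 / 2) * ∑ a, ∑ b, C i a b * A j a b
    = (∑ a, B j i a * D a) + (1 / 2) * ∑ a, ∑ b, C j a b * A i a b

end Relations

section Operators

variable {I : Type*} [Fintype I] [DecidableEq I]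

/-- Multiplication by the variable `x_a`, as a `ℂ[ħ]`-linear endomorphism of the
polynomial ring `ℂ[ħ][x_i : i ∈ I]`. -/
noncomputable def xOp (a : I) :
    Module.End (Polynomial ℂ) (MvPolynomial I (Polynomial ℂ)) :=
  LinearMap.mulLeft (Polynomial ℂ) (MvPolynomial.X a)

/-- The formal partial derivative `∂_a`, as a `ℂ[ħ]`-linear endomorphism of
`ℂ[ħ][x_i : i ∈ I]`. -/
noncomputable def dOp (a : I) :
    Module.End (Polynomial ℂ) (MvPolynomial I (Polynomial ℂ)) :=
  (MvPolynomial.pderiv a).toLinearMap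

/-- The operator `L_i = ħ∂_i − (1/2)Σ A^i_{ab} x_a x_b − ħ Σ B^i_{ab} x_a ∂_b
− (ħ²/2) Σ C^i_{ab} ∂_a ∂_b − ħ D^i`
(here `ħ = Polynomial.X` is the variable of the coefficient ring `ℂ[ħ]`). -/
noncomputable def Lop (A B C : I → I → I → ℂ) (D : I → ℂ) (i : I) :
    Module.End (Polynomial ℂ) (MvPolynomial I (Polynomial ℂ)) :=
  (Polynomial.X : Polynomial ℂ) • dOp i
    - ∑ a, ∑ b, Polynomial.C (A i a b / 2) • (xOp a * xOp b)
    - ∑ a, ∑ b, (Polynomial.X * Polynomial.C (B i a b)) • (xOp a * dOp b)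
    - ∑ a, ∑ b, (Polynomial.X ^ 2 * Polynomial.C (C i a b / 2)) • (dOp a * dOp b)
    - (Polynomial.X * Polynomial.C (D i)) •
        (1 : Module.End (Polynomial ℂ) (MvPolynomial I (Polynomial ℂ)))

end Operators

section Weyl

attribute [local instance] LieRing.ofAssociativeRing

variable {I R E : Type*} [Fintype I] [CommRing R] [Ring E] [Algebra R E]

/-- The linear element `∑ a, u a • y a`. -/
def linEl (u : I → R) (y : I → E) : E := ∑ a, u a • y a

/-- The quadratic element `∑ a b, P a b • (y a * z b)`. -/
def quadEl (P : I → I → R) (y z : I → E) : E := ∑ a, ∑ b, P a b • (y a * z b)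

lemma linEl_add (u v : I → R) (y : I → E) :
    linEl (fun a => u a + v a) y = linEl u y + linEl v y := by
  simp [linEl, add_smul, Finset.sum_add_distrib]

lemma linEl_sub (u v : I → R) (y : I → E) :
    linEl (fun a => u a - v a) y = linEl u y - linEl v y := by
  simp [linEl, sub_smul, Finset.sum_sub_distrib]

lemma linEl_neg (u : I → R) (y : I → E) :
    linEl (fun a => -u a) y = -linEl u y := by
  simp [linEl]

lemma linEl_smul (r : R) (u : I → R) (y : I → E) :
    linEl (fun a => r * u a) y = r • linEl u y := by
  simp [linEl, Finset.smul_sum, mul_smul]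

lemma linEl_zero (y : I → E) : linEl (fun _ => (0 : R)) y = 0 := by
  simp [linEl]

lemma quadEl_add (P Q : I → I → R) (y z : I → E) :
    quadEl (fun a b => P a b + Q a b) y z = quadEl P y z + quadEl Q y z := by
  simp [quadEl, add_smul, Finset.sum_add_distrib]

lemma quadEl_sub (P Q : I → I → R) (y z : I → E) :
    quadEl (fun a b => P a b - Q a b) y z = quadEl P y z - quadEl Q y z := by
  simp [quadEl, sub_smul, Finset.sum_sub_distrib]

lemma quadEl_zero (y z : I → E) : quadEl (fun _ _ => (0 : R)) y z = 0 := by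
  simp [quadEl]

lemma quadEl_sum_mul (F : I → R) (P : I → I → I → R) (y z : I → E) :
    quadEl (fun a b => ∑ c, F c * P c a b) y z = ∑ c, F c • quadEl (P c) y z := by
  simp only [quadEl, Finset.sum_smul, Finset.smul_sum, mul_smul]
  conv_rhs => rw [Finset.sum_comm]
  refine Finset.sum_congr rfl fun a _ => ?_
  rw [Finset.sum_comm]

lemma quadEl_swap {y : I → E} (hy : ∀ a b, ⁅y a, y b⁆ = 0) (P : I → I → R) :
    quadEl (fun a b => P b a) y y = quadEl P y y := by
  rw [quadEl, Finset.sum_comm, quadEl]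
  refine Finset.sum_congr rfl fun a _ => Finset.sum_congr rfl fun b _ => ?_
  rw [sub_eq_zero.mp ((Ring.lie_def _ _).symm.trans (hy a b))]

lemma lie_mul_leibniz (w y z : E) : ⁅w, y * z⁆ = ⁅w, y⁆ * z + y * ⁅w, z⁆ := by
  simp only [Ring.lie_def]; noncomm_ring

lemma mul_lie_leibniz (w y z : E) : ⁅y * z, w⁆ = ⁅y, w⁆ * z + y * ⁅z, w⁆ := by
  simp only [Ring.lie_def]; noncomm_ring

lemma lie_smul_comm (r : R) (w y : E) : ⁅w, r • y⁆ = r • ⁅w, y⁆ := by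
  simp only [Ring.lie_def, mul_smul_comm, smul_mul_assoc, smul_sub]

lemma lie_quadEl {w : E} {y z y' z' : I → E} (P M N : I → I → R)
    (hy : ∀ a, ⁅w, y a⁆ = linEl (M a) y') (hz : ∀ b, ⁅w, z b⁆ = linEl (N b) z') :
    ⁅w, quadEl P y z⁆ = quadEl (fun k b => ∑ a, P a b * M a k) y' z
      + quadEl (fun a l => ∑ b, P a b * N b l) y z' := by
  simp only [quadEl, lie_sum, lie_smul_comm, lie_mul_leibniz, hy, hz, linEl, smul_add,
    Finset.sum_add_distrib, Finset.sum_mul, Finset.mul_sum, Finset.sum_smul, Finset.smul_sum,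
    smul_mul_assoc, mul_smul_comm, mul_smul]
  congr 1
  · rw [Finset.sum_comm]
    conv_rhs => rw [Finset.sum_comm]
    refine Finset.sum_congr rfl fun a _ => ?_
    rw [Finset.sum_comm]
  · refine Finset.sum_congr rfl fun a _ => ?_
    rw [Finset.sum_comm]

lemma quadEl_lie_coord {y z : I → E} {w : E} (P : I → I → R) (m n : I → R)
    (hy : ∀ a, ⁅y a, w⁆ = m a • (1 : E)) (hz : ∀ a, ⁅z a, w⁆ = n a • (1 : E)) :
    ⁅quadEl P y z, w⁆ = linEl (fun b => ∑ a, P a b * m a) z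
      + linEl (fun a => ∑ b, P a b * n b) y := by
  simp only [quadEl, linEl, sum_lie, smul_lie, mul_lie_leibniz, hy, hz, smul_add,
    Finset.sum_add_distrib, Finset.sum_smul, smul_mul_assoc, mul_smul_comm, mul_smul,
    one_mul, mul_one]
  congr 1
  rw [Finset.sum_comm]

variable [DecidableEq I] {x d : I → E}

lemma quadEl_dx (hdx : ∀ a b, ⁅d a, x b⁆ = if a = b then 1 else 0) (P : I → I → R) :
    quadEl P d x = quadEl (fun a b => P b a) x d + (∑ a, P a a) • (1 : E) := by
  have h : ∀ a b, d a * x b = x b * d a + if a = b then 1 else 0 := fun a b => by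
    rw [← hdx, Ring.lie_def]; abel
  simp only [quadEl, h, smul_add, Finset.sum_add_distrib, smul_ite, smul_zero,
    Finset.sum_ite_eq, Finset.mem_univ, if_true, Finset.sum_smul]
  rw [Finset.sum_comm]

section Commutators

variable (hxx : ∀ a b, ⁅x a, x b⁆ = 0) (hdd : ∀ a b, ⁅d a, d b⁆ = 0)
  (hdx : ∀ a b, ⁅d a, x b⁆ = if a = b then 1 else 0)

omit [Fintype I] in
include hdx in
lemma lie_x_d (a b : I) : ⁅x a, d b⁆ = (if b = a then -1 else 0 : R) • (1 : E) := by
  rw [← lie_skew, hdx]; split_ifs <;> simp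

omit [Fintype I] in
include hdx in
lemma lie_d_x (a b : I) : ⁅d a, x b⁆ = (if a = b then 1 else 0 : R) • (1 : E) := by
  rw [hdx]; split_ifs <;> simp

include hxx hdx in
lemma quadEl_xd_lie_x (Q : I → I → R) (c : I) :
    ⁅quadEl Q x d, x c⁆ = linEl (fun a => Q a c) x := by
  rw [quadEl_lie_coord Q (fun _ => 0) (fun a => if a = c then 1 else 0)
    (fun a => by rw [hxx, zero_smul]) (fun a => lie_d_x hdx a c)]
  simp [linEl_zero]

include hdd hdx in
lemma quadEl_xd_lie_d (Q : I → I → R) (c : I) :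
    ⁅quadEl Q x d, d c⁆ = linEl (fun b => -Q c b) d := by
  rw [quadEl_lie_coord Q (fun a => if c = a then -1 else 0) (fun _ => 0)
    (fun a => lie_x_d hdx a c) (fun a => by rw [hdd, zero_smul])]
  simp [linEl_zero]

include hdx in
lemma quadEl_dd_lie_x (S : I → I → R) (c : I) :
    ⁅quadEl S d d, x c⁆ = linEl (fun b => S b c + S c b) d := by
  rw [quadEl_lie_coord S _ _ (fun a => lie_d_x hdx a c) (fun a => lie_d_x hdx a c),
    ← linEl_add]
  simp [add_comm]

omit [DecidableEq I] in
include hdd in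
lemma quadEl_dd_lie_d (S : I → I → R) (c : I) :
    ⁅quadEl S d d, d c⁆ = linEl (fun _ => (0 : R)) d := by
  rw [quadEl_lie_coord S (fun _ => 0) (fun _ => 0)
    (fun a => by rw [hdd, zero_smul]) (fun a => by rw [hdd, zero_smul])]
  simp [linEl_zero]

omit [DecidableEq I] in
include hxx in
lemma quadEl_xx_lie_x (P : I → I → R) (c : I) :
    ⁅quadEl P x x, x c⁆ = linEl (fun _ => (0 : R)) x := by
  rw [quadEl_lie_coord P (fun _ => 0) (fun _ => 0)
    (fun a => by rw [hxx, zero_smul]) (fun a => by rw [hxx, zero_smul])]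
  simp [linEl_zero]

include hdx in
lemma quadEl_xx_lie_d (P : I → I → R) (c : I) :
    ⁅quadEl P x x, d c⁆ = linEl (fun b => -(P b c + P c b)) x := by
  rw [quadEl_lie_coord P _ _ (fun a => lie_x_d hdx a c) (fun a => lie_x_d hdx a c),
    ← linEl_add]
  simp

omit [DecidableEq I] in
include hxx in
lemma quadEl_xx_lie_xx (P P' : I → I → R) : ⁅quadEl P x x, quadEl P' x x⁆ = 0 := by
  rw [lie_quadEl P' _ _ (quadEl_xx_lie_x hxx P) (quadEl_xx_lie_x hxx P)]
  simp [quadEl_zero]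

omit [DecidableEq I] in
include hdd in
lemma quadEl_dd_lie_dd (S S' : I → I → R) : ⁅quadEl S d d, quadEl S' d d⁆ = 0 := by
  rw [lie_quadEl S' _ _ (quadEl_dd_lie_d hdd S) (quadEl_dd_lie_d hdd S)]
  simp [quadEl_zero]

include hxx hdx in
lemma quadEl_xd_lie_xx (Q : I → I → R) {P : I → I → R} (hP : ∀ a b, P a b = P b a) :
    ⁅quadEl Q x d, quadEl P x x⁆ = quadEl (fun k l => ∑ a, 2 * (Q k a * P a l)) x x := by
  rw [lie_quadEl P _ _ (quadEl_xd_lie_x hxx hdx Q) (quadEl_xd_lie_x hxx hdx Q),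
    ← quadEl_swap hxx (fun a l => ∑ b, P a b * Q l b), ← quadEl_add]
  congr 1; ext k l
  rw [← Finset.sum_add_distrib]
  exact Finset.sum_congr rfl fun a _ => by rw [hP l a]; ring

include hxx hdd hdx in
lemma quadEl_xd_lie_xd (Q Q' : I → I → R) :
    ⁅quadEl Q x d, quadEl Q' x d⁆
      = quadEl (fun k l => ∑ a, (Q k a * Q' a l - Q' k a * Q a l)) x d := by
  rw [lie_quadEl Q' _ _ (quadEl_xd_lie_x hxx hdx Q) (quadEl_xd_lie_d hdd hdx Q),
    ← quadEl_add]
  congr 1; ext k l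
  rw [← Finset.sum_add_distrib]
  exact Finset.sum_congr rfl fun a _ => by ring

include hdd hdx in
lemma quadEl_dd_lie_xd {S : I → I → R} (hS : ∀ a b, S a b = S b a) (Q : I → I → R) :
    ⁅quadEl S d d, quadEl Q x d⁆ = quadEl (fun k l => ∑ a, 2 * (S k a * Q a l)) d d := by
  rw [lie_quadEl Q _ _ (quadEl_dd_lie_x hdx S) (quadEl_dd_lie_d hdd S)]
  simp only [mul_zero, Finset.sum_const_zero, quadEl_zero, add_zero]
  congr 1; ext k l
  exact Finset.sum_congr rfl fun a _ => by rw [hS k a]; ring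

include hdx in
lemma quadEl_dd_lie_xx {S P : I → I → R} (hS : ∀ a b, S a b = S b a)
    (hP : ∀ a b, P a b = P b a) :
    ⁅quadEl S d d, quadEl P x x⁆ = quadEl (fun k l => ∑ a, 4 * (S l a * P a k)) x d
      + (∑ a, ∑ b, 2 * (S a b * P a b)) • (1 : E) := by
  rw [lie_quadEl P _ _ (quadEl_dd_lie_x hdx S) (quadEl_dd_lie_x hdx S), quadEl_dx hdx,
    add_right_comm, ← quadEl_add]
  congr 2
  · ext k l
    rw [← Finset.sum_add_distrib]
    exact Finset.sum_congr rfl fun a _ => by rw [hS l a, hP k a]; ring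
  · exact Finset.sum_congr rfl fun a _ => Finset.sum_congr rfl fun b _ => by
      rw [hS a b, hP a b]; ring

include hxx hdd hdx in
/-- The bracket of two operators of order two in the Weyl algebra, in normal form. -/
lemma lie_normalForm {h : R} {i j : I} {P Q S P' Q' S' : I → I → R} {c c' : R}
    (hP : ∀ a b, P a b = P b a) (hS : ∀ a b, S a b = S b a)
    (hP' : ∀ a b, P' a b = P' b a) (hS' : ∀ a b, S' a b = S' b a) :
    ⁅h • d i - quadEl P x x - quadEl Q x d - quadEl S d d - c • (1 : E),
      h • d j - quadEl P' x x - quadEl Q' x d - quadEl S' d d - c' • (1 : E)⁆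
    = linEl (fun a => h * (P a j + P j a - (P' a i + P' i a))) x
      + linEl (fun a => h * (Q j a - Q' i a)) d
      + quadEl (fun k l => (∑ a, 2 * (Q k a * P' a l)) - ∑ a, 2 * (Q' k a * P a l)) x x
      + quadEl (fun k l => (∑ a, (Q k a * Q' a l - Q' k a * Q a l)) +
          ((∑ a, 4 * (S l a * P' a k)) - ∑ a, 4 * (S' l a * P a k))) x d
      + quadEl (fun k l => (∑ a, 2 * (S k a * Q' a l)) - ∑ a, 2 * (S' k a * Q a l)) d d
      + ((∑ a, ∑ b, 2 * (S a b * P' a b)) - ∑ a, ∑ b, 2 * (S' a b * P a b)) • (1 : E) := by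
  have e1 : ∀ w : E, ∀ r : R, ⁅w, r • (1 : E)⁆ = 0 := fun w r => by
    simp [Ring.lie_def]
  have e2 : ∀ w : E, ∀ r : R, ⁅r • (1 : E), w⁆ = 0 := fun w r => by
    simp [Ring.lie_def]
  have s1 : ∀ T : I → I → R, ⁅d i, quadEl T x x⁆ = -⁅quadEl T x x, d i⁆ :=
    fun T => (lie_skew _ _).symm
  have s2 : ∀ T : I → I → R, ⁅d i, quadEl T x d⁆ = -⁅quadEl T x d, d i⁆ :=
    fun T => (lie_skew _ _).symm
  have s3 : ∀ T : I → I → R, ⁅d i, quadEl T d d⁆ = -⁅quadEl T d d, d i⁆ :=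
    fun T => (lie_skew _ _).symm
  have s4 : ∀ T T' : I → I → R, ⁅quadEl T x x, quadEl T' x d⁆
      = -⁅quadEl T' x d, quadEl T x x⁆ := fun T T' => (lie_skew _ _).symm
  have s5 : ∀ T T' : I → I → R, ⁅quadEl T x x, quadEl T' d d⁆
      = -⁅quadEl T' d d, quadEl T x x⁆ := fun T T' => (lie_skew _ _).symm
  have s6 : ∀ T T' : I → I → R, ⁅quadEl T x d, quadEl T' d d⁆
      = -⁅quadEl T' d d, quadEl T x d⁆ := fun T T' => (lie_skew _ _).symm
  simp only [lie_sub, sub_lie, e1, e2, smul_lie, lie_smul_comm, s1, s2, s3, s4, s5, s6, hdd,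
    quadEl_xx_lie_xx hxx, quadEl_dd_lie_dd hdd, quadEl_xd_lie_d hdd hdx, quadEl_dd_lie_d hdd,
    quadEl_xx_lie_d hdx, quadEl_xd_lie_xx hxx hdx _ hP,
    quadEl_xd_lie_xx hxx hdx _ hP', quadEl_xd_lie_xd hxx hdd hdx, quadEl_dd_lie_xd hdd hdx hS,
    quadEl_dd_lie_xd hdd hdx hS', quadEl_dd_lie_xx hdx hS hP', quadEl_dd_lie_xx hdx hS' hP]
  simp only [linEl_zero, linEl_neg, linEl_smul, linEl_sub, quadEl_add, quadEl_sub,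
    sub_smul, smul_sub, smul_neg, smul_zero, linEl_add]
  abel

include hdx in
lemma linEl_x_lie_d (u : I → R) (c : I) : ⁅linEl u x, d c⁆ = (-u c) • (1 : E) := by
  simp only [linEl, sum_lie, smul_lie, lie_x_d (R := R) hdx, smul_smul, ← Finset.sum_smul]
  simp

include hdx in
lemma linEl_d_lie_x (v : I → R) (c : I) : ⁅linEl v d, x c⁆ = v c • (1 : E) := by
  simp only [linEl, sum_lie, smul_lie, lie_d_x (R := R) hdx, smul_smul, ← Finset.sum_smul]
  simp

omit [DecidableEq I] in
include hxx in
lemma linEl_x_lie_x (u : I → R) (c : I) : ⁅linEl u x, x c⁆ = 0 := by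
  simp [linEl, sum_lie, smul_lie, hxx]

omit [DecidableEq I] in
include hdd in
lemma linEl_d_lie_d (v : I → R) (c : I) : ⁅linEl v d, d c⁆ = 0 := by
  simp [linEl, sum_lie, smul_lie, hdd]

omit [DecidableEq I] in
lemma smul_one_lie (r : R) (w : E) : ⁅r • (1 : E), w⁆ = 0 := by
  simp [Ring.lie_def]

include hxx hdd hdx in
lemma affine_eq_zero (h1 : ∀ r : R, r • (1 : E) = 0 → r = 0) {u v : I → R} {c : R}
    (h : linEl u x + linEl v d + c • (1 : E) = 0) : u = 0 ∧ v = 0 ∧ c = 0 := by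
  have hu : u = 0 := funext fun k => by
    have := congrArg (⁅·, d k⁆) h
    simp only [add_lie, linEl_x_lie_d hdx, linEl_d_lie_d hdd, smul_one_lie, add_zero,
      zero_lie] at this
    simpa using h1 _ this
  have hv : v = 0 := funext fun k => by
    have := congrArg (⁅·, x k⁆) h
    simp only [add_lie, linEl_x_lie_x hxx, linEl_d_lie_x hdx, smul_one_lie, add_zero,
      zero_add, zero_lie] at this
    exact h1 _ this
  refine ⟨hu, hv, h1 c ?_⟩
  simpa [hu, hv, linEl] using h

omit [DecidableEq I] in
lemma quadEl_eq_zero {y : I → E} (hy : ∀ a b, ⁅y a, y b⁆ = 0) (h2 : IsUnit (2 : R))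
    {P : I → I → R} (hP : ∀ a b, P a b + P b a = 0) : quadEl P y y = 0 := by
  have h : (2 : R) • quadEl P y y = 0 := by
    rw [two_smul]
    nth_rw 2 [← quadEl_swap hy]
    rw [← quadEl_add]
    simp [hP, quadEl_zero]
  exact h2.smul_eq_zero.mp h

include hxx hdd hdx in
/-- Uniqueness of normal forms of order two in the Weyl algebra. -/
lemma normalForm_eq_zero_iff (h1 : ∀ r : R, r • (1 : E) = 0 → r = 0) (h2 : IsUnit (2 : R))
    {u v : I → R} {P Q S : I → I → R} {c : R} :
    linEl u x + linEl v d + quadEl P x x + quadEl Q x d + quadEl S d d + c • (1 : E) = 0 ↔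
      (∀ a, u a = 0) ∧ (∀ a, v a = 0) ∧ (∀ a b, P a b + P b a = 0) ∧ (∀ a b, Q a b = 0) ∧
        (∀ a b, S a b + S b a = 0) ∧ c = 0 := by
  constructor
  · intro h
    have hx : ∀ k, (fun a => Q a k) = 0 ∧ (fun b => S b k + S k b) = 0 ∧ v k = 0 := by
      intro k
      have := congrArg (⁅·, x k⁆) h
      simp only [add_lie, linEl_x_lie_x hxx, linEl_d_lie_x hdx, smul_one_lie, add_zero,
        zero_add, zero_lie, quadEl_xx_lie_x hxx, quadEl_xd_lie_x hxx hdx,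
        quadEl_dd_lie_x hdx, linEl_zero] at this
      exact affine_eq_zero hxx hdd hdx h1 (by rw [← this]; abel)
    have hd : ∀ k, (fun b => -(P b k + P k b)) = 0 ∧ (fun b => -Q k b) = 0 ∧ -u k = 0 := by
      intro k
      have := congrArg (⁅·, d k⁆) h
      simp only [add_lie, linEl_x_lie_d hdx, linEl_d_lie_d hdd, smul_one_lie, add_zero,
        zero_lie, quadEl_xx_lie_d hdx, quadEl_xd_lie_d hdd hdx,
        quadEl_dd_lie_d hdd, linEl_zero] at this
      exact affine_eq_zero hxx hdd hdx h1 (by rw [← this]; abel)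
    have hu : ∀ a, u a = 0 := fun a => neg_eq_zero.mp (hd a).2.2
    have hv : ∀ a, v a = 0 := fun a => (hx a).2.2
    have hP : ∀ a b, P a b + P b a = 0 := fun a b => neg_eq_zero.mp (congrFun (hd b).1 a)
    have hQ : ∀ a b, Q a b = 0 := fun a b => congrFun (hx b).1 a
    have hS : ∀ a b, S a b + S b a = 0 := fun a b => congrFun (hx b).2.1 a
    refine ⟨hu, hv, hP, hQ, hS, h1 c ?_⟩
    rw [quadEl_eq_zero hxx h2 hP, quadEl_eq_zero hdd h2 hS] at h
    simpa [linEl, quadEl, hu, hv, hQ] using h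
  · rintro ⟨hu, hv, hP, hQ, hS, rfl⟩
    rw [quadEl_eq_zero hxx h2 hP, quadEl_eq_zero hdd h2 hS]
    simp [linEl, quadEl, hu, hv, hQ]

include hxx hdd hdx in
lemma lie_eq_sum_smul_iff (h1 : ∀ r : R, r • (1 : E) = 0 → r = 0) (h2 : IsUnit (2 : R))
    {h : R} {P Q S : I → I → I → R} {c : I → R} {L : I → E}
    (hL : ∀ i, L i = h • d i - quadEl (P i) x x - quadEl (Q i) x d - quadEl (S i) d d
      - c i • (1 : E))
    (hP : ∀ i a b, P i a b = P i b a) (hS : ∀ i a b, S i a b = S i b a)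
    (F : I → R) (i j : I) :
    ⁅L i, L j⁆ = ∑ a, F a • L a ↔
      (∀ k, h * (P i k j + P i j k - (P j k i + P j i k)) = 0) ∧
      (∀ k, h * (Q i j k - Q j i k) - h * F k = 0) ∧
      (∀ k l, ∑ a, (2 * (Q i k a * P j a l) - 2 * (Q j k a * P i a l) + F a * P a k l)
        + ∑ a, (2 * (Q i l a * P j a k) - 2 * (Q j l a * P i a k) + F a * P a l k) = 0) ∧
      (∀ k l, ∑ a, (Q i k a * Q j a l - Q j k a * Q i a l +
        (4 * (S i l a * P j a k) - 4 * (S j l a * P i a k)) + F a * Q a k l) = 0) ∧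
      (∀ k l, ∑ a, (2 * (S i k a * Q j a l) - 2 * (S j k a * Q i a l) + F a * S a k l)
        + ∑ a, (2 * (S i l a * Q j a k) - 2 * (S j l a * Q i a k) + F a * S a l k) = 0) ∧
      (∑ a, ∑ b, 2 * (S i a b * P j a b)) - (∑ a, ∑ b, 2 * (S j a b * P i a b))
        + ∑ a, F a * c a = 0 := by
  have hsum : ∑ a, F a • L a = linEl (fun a => h * F a) d
      - quadEl (fun k l => ∑ a, F a * P a k l) x x - quadEl (fun k l => ∑ a, F a * Q a k l) x d
      - quadEl (fun k l => ∑ a, F a * S a k l) d d - (∑ a, F a * c a) • (1 : E) := by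
    simp only [hL, smul_sub, Finset.sum_sub_distrib, quadEl_sum_mul, linEl_smul]
    simp only [linEl, Finset.smul_sum, Finset.sum_smul, mul_smul, smul_comm h]
  rw [← sub_eq_zero, hsum, hL i, hL j,
    lie_normalForm hxx hdd hdx (hP i) (hS i) (hP j) (hS j)]
  simp only [Finset.sum_add_distrib, Finset.sum_sub_distrib]
  rw [← normalForm_eq_zero_iff hxx hdd hdx h1 h2]
  simp only [linEl_sub, quadEl_add, quadEl_sub, add_smul, sub_smul]
  refine Eq.congr ?_ rfl
  abel

end Commutators

end Weyl

section Concrete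

variable {I : Type*}

lemma xOp_mul_comm (a b : I) : xOp a * xOp b - xOp b * xOp a = 0 := by
  refine LinearMap.ext fun p => ?_
  simp only [xOp, LinearMap.sub_apply, Module.End.mul_apply,
    LinearMap.mulLeft_apply, LinearMap.zero_apply]
  ring

lemma dOp_mul_comm (a b : I) : dOp a * dOp b - dOp b * dOp a = 0 := by
  classical
  have h : ⁅MvPolynomial.pderiv (R := Polynomial ℂ) a,
      MvPolynomial.pderiv (R := Polynomial ℂ) b⁆ = 0 := by
    refine MvPolynomial.derivation_ext fun k => ?_
    simp [Derivation.commutator_apply, MvPolynomial.pderiv_X, Pi.single_apply, apply_ite]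
  exact LinearMap.ext fun p => DFunLike.congr_fun h p

lemma dOp_xOp_commutator [DecidableEq I] (a b : I) :
    dOp a * xOp b - xOp b * dOp a = if a = b then 1 else 0 := by
  refine LinearMap.ext fun p => ?_
  simp only [xOp, dOp, LinearMap.sub_apply, Module.End.mul_apply,
    LinearMap.mulLeft_apply, Derivation.coeFn_coe,
    MvPolynomial.pderiv_mul, add_sub_cancel_right]
  rcases eq_or_ne a b with rfl | hab
  · simp
  · simp [MvPolynomial.pderiv_X_of_ne hab.symm, hab]

variable [Fintype I]

lemma Lop_eq (A B C : I → I → I → ℂ) (D : I → ℂ) (i : I) :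
    Lop A B C D i = (Polynomial.X : Polynomial ℂ) • dOp i
      - quadEl (fun a b => Polynomial.C (A i a b / 2)) xOp xOp
      - quadEl (fun a b => Polynomial.X * Polynomial.C (B i a b)) xOp dOp
      - quadEl (fun a b => Polynomial.X ^ 2 * Polynomial.C (C i a b / 2)) dOp dOp
      - (Polynomial.X * Polynomial.C (D i)) • 1 := rfl

lemma X_pow_mul_C_eq_zero (n : ℕ) (z : ℂ) :
    Polynomial.X ^ n * Polynomial.C z = 0 ↔ z = 0 := by
  simp

lemma Lop_commutator_iff [DecidableEq I] {A B C : I → I → I → ℂ} (D : I → ℂ)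
    (hA : ∀ i j k, A i j k = A i k j) (hC : ∀ i j k, C i j k = C i k j)
    (f : I → ℂ) (i j : I) :
    Lop A B C D i * Lop A B C D j - Lop A B C D j * Lop A B C D i
        = ∑ a, (Polynomial.X * Polynomial.C (f a)) • Lop A B C D a ↔
      (∀ k, A i j k - A j i k = 0) ∧
      (∀ k, B i j k - B j i k - f k = 0) ∧
      (∀ k l, ∑ a, (B i k a * A j a l - B j k a * A i a l + B i l a * A j a k
        - B j l a * A i a k + f a * A a k l) = 0) ∧
      (∀ k l, ∑ a, (B i k a * B j a l - B j k a * B i a l + C i l a * A j a k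
        - C j l a * A i a k + f a * B a k l) = 0) ∧
      (∀ k l, ∑ a, (C i k a * B j a l - C j k a * B i a l + C i l a * B j a k
        - C j l a * B i a k + f a * C a k l) = 0) ∧
      1 / 2 * (∑ a, ∑ b, C i a b * A j a b) - 1 / 2 * (∑ a, ∑ b, C j a b * A i a b)
        + ∑ a, f a * D a = 0 := by
  have h1 : ∀ r : Polynomial ℂ,
      r • (1 : Module.End (Polynomial ℂ) (MvPolynomial I (Polynomial ℂ))) = 0 → r = 0 := by
    intro r hr
    have := LinearMap.congr_fun hr 1
    simpa [MvPolynomial.smul_eq_C_mul] using this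
  have h2 : IsUnit (2 : Polynomial ℂ) := by
    have := (IsUnit.mk0 (2 : ℂ) two_ne_zero).map Polynomial.C
    rwa [Polynomial.C_ofNat] at this
  have half : ∀ z : ℂ, (2 : Polynomial ℂ) * Polynomial.C (z / 2) = Polynomial.C z := fun z => by
    rw [← Polynomial.C_ofNat, ← Polynomial.C_mul]; congr 1; ring
  refine (lie_eq_sum_smul_iff (R := Polynomial ℂ)
    (E := Module.End (Polynomial ℂ) (MvPolynomial I (Polynomial ℂ)))
    (x := xOp) (d := dOp) xOp_mul_comm dOp_mul_comm dOp_xOp_commutator h1 h2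
    (h := Polynomial.X) (P := fun i a b => Polynomial.C (A i a b / 2))
    (Q := fun i a b => Polynomial.X * Polynomial.C (B i a b))
    (S := fun i a b => Polynomial.X ^ 2 * Polynomial.C (C i a b / 2))
    (c := fun i => Polynomial.X * Polynomial.C (D i)) (L := Lop A B C D)
    (Lop_eq A B C D) (fun i a b => by rw [hA]) (fun i a b => by rw [hC])
    (fun a => Polynomial.X * Polynomial.C (f a)) i j).trans ?_
  refine and_congr (forall_congr' fun k => ?_) <| and_congr (forall_congr' fun k => ?_) <|
    and_congr (forall₂_congr fun k l => ?_) <| and_congr (forall₂_congr fun k l => ?_) <|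
    and_congr (forall₂_congr fun k l => ?_) ?_
  · rw [← X_pow_mul_C_eq_zero 1, hA i k j, hA j k i]
    refine Eq.congr ?_ rfl
    simp only [map_sub, ← half (A _ _ _)]
    ring
  · rw [← X_pow_mul_C_eq_zero 2]
    refine Eq.congr ?_ rfl
    simp only [map_sub]
    ring
  · rw [← X_pow_mul_C_eq_zero 1, ← Finset.sum_add_distrib, map_sum, Finset.mul_sum]
    refine Eq.congr (Finset.sum_congr rfl fun a _ => ?_) rfl
    simp only [map_sub, map_add, map_mul, ← half (A _ _ _), hA a l k]
    ring
  · rw [← X_pow_mul_C_eq_zero 2, map_sum, Finset.mul_sum]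
    refine Eq.congr (Finset.sum_congr rfl fun a _ => ?_) rfl
    simp only [map_sub, map_add, map_mul, ← half (A _ _ _), ← half (C _ _ _)]
    ring
  · rw [← X_pow_mul_C_eq_zero 3, ← Finset.sum_add_distrib, map_sum, Finset.mul_sum]
    refine Eq.congr (Finset.sum_congr rfl fun a _ => ?_) rfl
    simp only [map_sub, map_add, map_mul, ← half (C _ _ _), hC a l k]
    ring
  · rw [← X_pow_mul_C_eq_zero 2]
    refine Eq.congr ?_ rfl
    simp only [map_sub, map_add, map_sum, mul_add, mul_sub, Finset.mul_sum]
    refine congrArg₂ (· + ·) (congrArg₂ (· - ·) ?_ ?_) ?_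
    iterate 2
      · refine Finset.sum_congr rfl fun a _ => Finset.sum_congr rfl fun b _ => ?_
        rw [show ∀ u v : ℂ, 1 / 2 * (u * v) = 2 * (u / 2 * (v / 2)) from fun u v => by ring]
        simp only [map_mul, Polynomial.C_ofNat]
        ring
    · refine Finset.sum_congr rfl fun a _ => ?_
      rw [map_mul]
      ring

end Concrete

/-- The operators `(L_i)` span a Lie subalgebra, i.e. there are scalars `f^k_{i,j}` with
`[L_i, L_j] = ħ Σ_a f^a_{i,j} L_a`, if and only if the tensors `(A,B,C,D)` satisfy the
relations (SymA), (BB-AC), (BC), (BA) and (D); moreover any such scalars are necessarily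
`f^k_{i,j} = B^i_{j,k} − B^j_{i,k}`. -/
theorem stmt0 {I : Type*} [Fintype I] [DecidableEq I]
    (A B C : I → I → I → ℂ) (D : I → ℂ)
    (hA : ∀ i j k, A i j k = A i k j) (hC : ∀ i j k, C i j k = C i k j) :
    ((∃ f : I → I → I → ℂ, ∀ i j,
        Lop A B C D i * Lop A B C D j - Lop A B C D j * Lop A B C D i
          = ∑ a, (Polynomial.X * Polynomial.C (f i j a)) • Lop A B C D a) ↔
      ((∀ i j k, A i j k = A j i k) ∧ RelBBAC A B C ∧ RelBC B C ∧ RelBA A B ∧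
        RelD A B C D))
    ∧ (∀ f : I → I → I → ℂ,
        (∀ i j, Lop A B C D i * Lop A B C D j - Lop A B C D j * Lop A B C D i
          = ∑ a, (Polynomial.X * Polynomial.C (f i j a)) • Lop A B C D a) →
        ∀ i j k, f i j k = B i j k - B j i k) := by
  have rels : (∀ i j, Lop A B C D i * Lop A B C D j - Lop A B C D j * Lop A B C D i
        = ∑ a, (Polynomial.X * Polynomial.C (B i j a - B j i a)) • Lop A B C D a) ↔
      ((∀ i j k, A i j k = A j i k) ∧ RelBBAC A B C ∧ RelBC B C ∧ RelBA A B ∧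
        RelD A B C D) := by
    simp only [Lop_commutator_iff D hA hC, forall_and, RelBBAC, RelBC, RelBA, RelD]
    constructor
    · rintro ⟨h1, -, h3, h4, h5, h6⟩
      refine ⟨fun i j k => sub_eq_zero.mp (h1 i j k), fun i j k l => ?_, fun i j k l => ?_,
        fun i j k l => ?_, fun i j => ?_⟩
      · rw [← sub_eq_zero, ← Finset.sum_sub_distrib, ← h4 i j k l]
        exact Finset.sum_congr rfl fun a _ => by ring
      · rw [← sub_eq_zero, ← Finset.sum_sub_distrib, ← h5 i j k l]
        exact Finset.sum_congr rfl fun a _ => by ring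
      · rw [← sub_eq_zero, ← Finset.sum_sub_distrib, ← h3 i j k l]
        exact Finset.sum_congr rfl fun a _ => by ring
      · have := h6 i j
        simp only [sub_mul, Finset.sum_sub_distrib] at this
        linear_combination this
    · rintro ⟨h1, h4, h5, h3, h6⟩
      refine ⟨fun i j k => sub_eq_zero.mpr (h1 i j k), fun i j k => sub_self _,
        fun i j k l => ?_, fun i j k l => ?_, fun i j k l => ?_, fun i j => ?_⟩
      · rw [← sub_eq_zero.mpr (h3 i j k l), ← Finset.sum_sub_distrib]
        exact Finset.sum_congr rfl fun a _ => by ring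
      · rw [← sub_eq_zero.mpr (h4 i j k l), ← Finset.sum_sub_distrib]
        exact Finset.sum_congr rfl fun a _ => by ring
      · rw [← sub_eq_zero.mpr (h5 i j k l), ← Finset.sum_sub_distrib]
        exact Finset.sum_congr rfl fun a _ => by ring
      · simp only [sub_mul, Finset.sum_sub_distrib]
        linear_combination h6 i j
  have uniq : ∀ f : I → I → I → ℂ,
      (∀ i j, Lop A B C D i * Lop A B C D j - Lop A B C D j * Lop A B C D i
        = ∑ a, (Polynomial.X * Polynomial.C (f i j a)) • Lop A B C D a) →
      ∀ i j k, f i j k = B i j k - B j i k := fun f hf i j k =>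
    (sub_eq_zero.mp (((Lop_commutator_iff D hA hC (f i j) i j).mp (hf i j)).2.1 k)).symm
  refine ⟨⟨fun ⟨f, hf⟩ => rels.mp ?_, fun h => ⟨_, rels.mpr h⟩⟩, uniq⟩
  simpa only [uniq f hf] using hf
end

section
/- Let I be a finite index set and suppose the tensors (A,B,C,D), with A^i_{j,k} = A^i_{k,j} and C^i_{j,k} = C^i_{k,j}, satisfy the relations (SymA), (BB-AC), (BC), (BA) and (D). Then for every g ≥ 0 and n ≥ 1 with 2g−2+n > 0, the topological-recursion amplitude F_{g,n} is invariant under every permutation of its arguments: F_{g,n}(i_{σ(1)}, …, i_{σ(n)}) = F_{g,n}(i_1, …, i_n) for all i_1,…,i_n ∈ I and all permutations σ of {1,…,n}. -/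
open Finset

/-- The Kontsevich–Soibelman topological recursion amplitudes `F_{g,n}` associated to
tensors `(A,B,C,D)`.  Sums over the index type `ι` are finsums (equal to the usual finite
sums when `ι` is a `Fintype`); terms involving the unstable amplitudes `F_{0,1}` and
`F_{0,2}` are set to zero. -/
noncomputable def TRF {ι : Type*} (A B C : ι → ι → ι → ℂ) (D : ι → ℂ) :
    (g : ℕ) → (n : ℕ) → (Fin n → ι) → ℂ
  | _, 0, _ => 0
  | g, n + 1, v =>
    if g = 0 ∧ n = 2 then A (v 0) (v 1) (v 2)
    else if g = 1 ∧ n = 0 then D (v 0)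
    else if 2 * g + n < 3 then 0
    else
      (∑ m : Fin n, ∑ᶠ a : ι,
        B (v 0) (v m.succ) a *
          TRF A B C D g (({m}ᶜ : Finset (Fin n)).card + 1)
            (Fin.cons a fun j => Fin.tail v ((({m}ᶜ : Finset (Fin n)).orderIsoOfFin rfl) j).1))
      + (1 / 2) * ∑ᶠ a : ι, ∑ᶠ b : ι, C (v 0) a b *
          ((if hg : g = 0 then 0 else
              TRF A B C D (g - 1) (n + 2) (Fin.cons a (Fin.cons b (Fin.tail v))))
           + ∑ h' ∈ (Finset.range (g + 1)).attach, ∑ S : Finset (Fin n),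
               if hS : 2 * h'.1 + S.card = 0 ∨ 2 * (g - h'.1) + (Sᶜ : Finset (Fin n)).card = 0
               then 0
               else
                 TRF A B C D h'.1 (S.card + 1)
                   (Fin.cons a fun j => Fin.tail v ((S.orderIsoOfFin rfl) j).1) *
                 TRF A B C D (g - h'.1) ((Sᶜ : Finset (Fin n)).card + 1)
                   (Fin.cons b fun j => Fin.tail v (((Sᶜ : Finset (Fin n)).orderIsoOfFin rfl) j).1))
  termination_by g n _ => 2 * g + n
  decreasing_by
  all_goals
    first
    | (have h1 := m.isLt
       have h2 : ({m}ᶜ : Finset (Fin n)).card = n - 1 := by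
         simp [Finset.card_compl]
       omega)
    | omega
    | (have h1 : h'.1 ≤ g := by
         have := h'.2
         simp only [Finset.mem_range] at this
         omega
       have h2 : S.card ≤ n := le_trans (Finset.card_le_univ S) (by simp)
       have h3 : (Sᶜ : Finset (Fin n)).card = n - S.card := by
         simp [Finset.card_compl]
       omega)

section TensorIdentity

variable {I R : Type*} [Fintype I] [CommRing R]

theorem sum_mul_sum_sum_mul (f : I → R) (g : I → I → I → R) (z : I → I → R) :
    ∑ a, f a * ∑ k, ∑ l, g a k l * z k l = ∑ k, ∑ l, (∑ a, f a * g a k l) * z k l := by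
  simp only [Finset.mul_sum, Finset.sum_mul]
  rw [Finset.sum_comm]
  refine Finset.sum_congr rfl fun k _ => ?_
  rw [Finset.sum_comm]
  simp only [mul_assoc]

theorem sum_sum_mul_mul_sum_mul (p q : I → I → R) (y z : I → R) :
    ∑ b, (∑ k, p k b * y k) * ∑ l, q b l * z l
      = ∑ k, ∑ l, (∑ b, p k b * q b l) * (y k * z l) := by
  simp only [Finset.mul_sum, Finset.sum_mul]
  rw [Finset.sum_congr rfl fun b _ => Finset.sum_comm, Finset.sum_comm]
  refine Finset.sum_congr rfl fun k _ => ?_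
  rw [Finset.sum_comm]
  refine Finset.sum_congr rfl fun l _ => Finset.sum_congr rfl fun b _ => ?_
  ring

theorem sum_sum_mul_sum_mul (p q : I → I → R) (z : I → I → R) :
    ∑ a, ∑ b, p a b * ∑ c, q b c * z c a = ∑ k, ∑ l, (∑ b, p k b * q b l) * z l k := by
  simp only [Finset.mul_sum, Finset.sum_mul]
  refine Finset.sum_congr rfl fun k _ => ?_
  rw [Finset.sum_comm]
  simp only [mul_assoc]

theorem sum_pair_comm (f : I → I → I → I → R) :
    ∑ a, ∑ b, ∑ c, ∑ d, f a b c d = ∑ a, ∑ b, ∑ c, ∑ d, f c d a b := by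
  simp only [← Fintype.sum_prod_type']
  have := Finset.sum_comm (s := (Finset.univ : Finset (I × I)))
    (t := (Finset.univ : Finset (I × I))) (f := fun p q => f p.1 p.2 q.1 q.2)
  simpa only [Fintype.sum_prod_type] using this

theorem sum_symmetrize (h : R) (h_two : h + h = 1) (p q : I → I → I → R) (z : I → I → R)
    (hz : ∀ k l, z k l = z l k) :
    h * (∑ k, ∑ l, (∑ a, p a k l) * z k l) + ∑ k, ∑ l, (∑ a, q a k l) * z k l
      = h * ∑ k, ∑ l, (∑ a, (p a k l + q a k l + q a l k)) * z k l := by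
  have e : ∑ k, ∑ l, (∑ a, q a l k) * z k l = ∑ k, ∑ l, (∑ a, q a k l) * z k l := by
    rw [Finset.sum_comm]
    simp only [fun k l => hz l k]
  simp only [Finset.sum_add_distrib, add_mul, mul_add, e]
  linear_combination -(∑ k, ∑ l, (∑ a, q a k l) * z k l) * h_two

/-- The part of the first derivative of the recursion that is not symmetric by `SymA`. -/
theorem recursion_derivative_symm (A B C : I → I → I → R) (D : I → R) (h t : R)
    (h_two : h + h = 1) (hC : ∀ i j k, C i j k = C i k j)
    (hBBAC : ∀ i j k l, ∑ a, (B i j a * B a k l + B i k a * B j a l + C i l a * A j a k)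
      = ∑ a, (B j i a * B a k l + B j k a * B i a l + C j l a * A i a k))
    (hBC : ∀ i j k l, ∑ a, (B i j a * C a k l + C i k a * B j a l + C i l a * B j a k)
      = ∑ a, (B j i a * C a k l + C j k a * B i a l + C j l a * B i a k))
    (hBA : ∀ i j k l, ∑ a, (B i j a * A a k l + B i k a * A j a l + B i l a * A j a k)
      = ∑ a, (B j i a * A a k l + B j k a * A i a l + B j l a * A i a k))
    (hD : ∀ i j, ∑ a, B i j a * D a + h * ∑ a, ∑ b, C i a b * A j a b
      = ∑ a, B j i a * D a + h * ∑ a, ∑ b, C j a b * A i a b)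
    (hA : ∀ i j k, A i j k = A i k j)
    (y w : I → R) (μ Q : I → I → R) (H : I → I → I → R) (K : I → I → I → I → R)
    (hμ : ∀ i b, t * μ i b = ∑ k, B i k b * y k + ∑ k, C i k b * w k)
    (hw : ∀ i, w i = h * (∑ k, ∑ l, A i k l * (y k * y l)) + ∑ k, ∑ l, B i k l * (y k * w l)
      + h * (∑ k, ∑ l, C i k l * (t * Q k l + w k * w l)) + t ^ 2 * D i)
    (hQ : ∀ i j, Q i j = t * (∑ l, A i j l * y l + ∑ l, B i j l * w l)
      + ∑ b, t * μ i b * Q b j + h * t * ∑ a, ∑ b, C i a b * H b a j)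
    (hH : ∀ j b a, H j b a = t * (t * A j b a + ∑ c, B j b c * Q c a)
      + ∑ c, (t * B j a c + ∑ e, C j e c * Q e a) * Q c b + ∑ c, t * μ j c * H c b a
      + h * t * ∑ c, ∑ d, C j c d * K d c b a)
    (hQs : ∀ a b, Q a b = Q b a) (hH1 : ∀ a b c, H a b c = H b a c)
    (hH2 : ∀ a b c, H a b c = H a c b) (hK : ∀ a b c d, K a b c d = K c d a b) (i j : I) :
    ∑ a, B i j a * w a + ∑ b, μ i b * Q b j + h * ∑ a, ∑ b, C i a b * H b a j
      = ∑ a, B j i a * w a + ∑ b, μ j b * Q b i + h * ∑ a, ∑ b, C j a b * H b a i := by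
  have T1 : ∀ i j, ∑ a, B i j a * w a
      = h * (∑ k, ∑ l, (∑ a, B i j a * A a k l) * (y k * y l))
        + ∑ k, ∑ l, (∑ a, B i j a * B a k l) * (y k * w l)
        + h * (∑ k, ∑ l, (∑ a, B i j a * C a k l) * (t * Q k l + w k * w l))
        + t ^ 2 * ∑ a, B i j a * D a := by
    intro i j
    rw [← sum_mul_sum_sum_mul, ← sum_mul_sum_sum_mul, ← sum_mul_sum_sum_mul, Finset.mul_sum,
      Finset.mul_sum, Finset.mul_sum, ← Finset.sum_add_distrib, ← Finset.sum_add_distrib,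
      ← Finset.sum_add_distrib]
    refine Finset.sum_congr rfl fun a _ => ?_
    rw [hw a]
    ring
  have T2 : ∀ i j, ∑ b, μ i b * Q b j
      = ∑ k, ∑ l, (∑ b, B i k b * A j b l) * (y k * y l)
        + ∑ k, ∑ l, (∑ b, B i k b * B j b l) * (y k * w l)
        + ∑ k, ∑ l, (∑ b, C i k b * A j b l) * (w k * y l)
        + ∑ k, ∑ l, (∑ b, C i k b * B j b l) * (w k * w l)
        + t * ∑ b, ∑ c, μ i b * (μ j c * Q c b)
        + h * t * ∑ b, μ i b * ∑ c, ∑ d, C j c d * H d c b := by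
    intro i j
    simp only [← sum_sum_mul_mul_sum_mul]
    rw [Finset.mul_sum, Finset.mul_sum]
    simp only [← Finset.sum_add_distrib]
    refine Finset.sum_congr rfl fun b _ => ?_
    rw [hQs b j, hQ j b, ← Finset.mul_sum]
    simp only [mul_assoc, ← Finset.mul_sum]
    linear_combination (∑ l, A j b l * y l + ∑ l, B j b l * w l) * hμ i b
  have T3 : ∀ i j, ∑ a, ∑ b, C i a b * H b a j
      = t ^ 2 * (∑ a, ∑ b, C i a b * A j a b)
        + t * (∑ k, ∑ l, (∑ b, C i k b * B j b l) * Q l k)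
        + t * (∑ k, ∑ l, (∑ b, C i k b * B j b l) * Q l k)
        + ∑ a, ∑ b, C i a b * ∑ c, (∑ e, C j e c * Q e a) * Q c b
        + t * (∑ c, μ j c * ∑ a, ∑ b, C i a b * H b a c)
        + h * t * ∑ a, ∑ b, C i a b * ∑ c, ∑ d, C j c d * K d c b a := by
    intro i j
    have e1 : ∑ k, ∑ l, (∑ b, C i k b * B j b l) * Q l k
        = ∑ a, ∑ b, C i a b * ∑ c, B j a c * Q c b := by
      rw [← sum_sum_mul_sum_mul, Finset.sum_comm]
      simp only [fun a b => hC i a b]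
    have e2 : ∑ c, μ j c * ∑ a, ∑ b, C i a b * H b a c
        = ∑ a, ∑ b, C i a b * ∑ c, μ j c * H b a c := by
      simp only [Finset.mul_sum]
      rw [Finset.sum_comm]
      refine Finset.sum_congr rfl fun a _ => ?_
      rw [Finset.sum_comm]
      refine Finset.sum_congr rfl fun b _ => Finset.sum_congr rfl fun c _ => ?_
      ring
    nth_rewrite 2 [e1]
    rw [← sum_sum_mul_sum_mul, e2]
    have key : ∀ a b, C i a b * H b a j
        = t ^ 2 * (C i a b * A j a b) + t * (C i a b * ∑ c, B j b c * Q c a)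
          + t * (C i a b * ∑ c, B j a c * Q c b)
          + C i a b * ∑ c, (∑ e, C j e c * Q e a) * Q c b
          + t * (C i a b * ∑ c, μ j c * H b a c)
          + h * t * (C i a b * ∑ c, ∑ d, C j c d * K d c b a) := by
      intro a b
      have e3 : ∑ c, (t * B j a c + ∑ e, C j e c * Q e a) * Q c b
          = t * (∑ c, B j a c * Q c b) + ∑ c, (∑ e, C j e c * Q e a) * Q c b := by
        rw [Finset.mul_sum, ← Finset.sum_add_distrib]
        exact Finset.sum_congr rfl fun c _ => by ring
      have e4 : ∑ c, t * μ j c * H c b a = t * ∑ c, μ j c * H b a c := by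
        rw [Finset.mul_sum]
        exact Finset.sum_congr rfl fun c _ => by rw [hH1 c b a, hH2 b c a]; ring
      rw [hH2 b a j, hH1 b j a, hH j b a, e3, e4, hA j b a]
      ring
    simp only [key, Finset.sum_add_distrib, ← Finset.mul_sum]
  have sQQ : ∑ a, ∑ b, C i a b * ∑ c, (∑ e, C j e c * Q e a) * Q c b
      = ∑ a, ∑ b, C j a b * ∑ c, (∑ e, C i e c * Q e a) * Q c b := by
    simp only [Finset.mul_sum, Finset.sum_mul]
    have flip : ∀ f : I → I → I → I → R,
        ∑ a, ∑ b, ∑ c, ∑ e, f a b c e = ∑ a, ∑ b, ∑ e, ∑ c, f e c b a := by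
      intro f
      rw [sum_pair_comm, Finset.sum_comm]
    rw [flip]
    refine Finset.sum_congr rfl fun a _ => Finset.sum_congr rfl fun b _ => ?_
    rw [Finset.sum_comm]
    refine Finset.sum_congr rfl fun c _ => Finset.sum_congr rfl fun e _ => ?_
    rw [hQs e a, hQs c b]
    ring
  have sK : ∑ a, ∑ b, C i a b * ∑ c, ∑ d, C j c d * K d c b a
      = ∑ a, ∑ b, C j a b * ∑ c, ∑ d, C i c d * K d c b a := by
    simp only [Finset.mul_sum]
    rw [sum_pair_comm]
    refine Finset.sum_congr rfl fun a _ => Finset.sum_congr rfl fun b _ =>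
      Finset.sum_congr rfl fun c _ => Finset.sum_congr rfl fun d _ => ?_
    rw [hK b a d c]
    ring
  have sμ : ∑ b, ∑ c, μ i b * (μ j c * Q c b) = ∑ b, ∑ c, μ j b * (μ i c * Q c b) := by
    rw [Finset.sum_comm]
    refine Finset.sum_congr rfl fun b _ => Finset.sum_congr rfl fun c _ => ?_
    rw [hQs b c]
    ring
  have rBA : h * (∑ k, ∑ l, (∑ a, B i j a * A a k l) * (y k * y l))
        + ∑ k, ∑ l, (∑ b, B i k b * A j b l) * (y k * y l)
      = h * (∑ k, ∑ l, (∑ a, B j i a * A a k l) * (y k * y l))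
        + ∑ k, ∑ l, (∑ b, B j k b * A i b l) * (y k * y l) := by
    have hz : ∀ k l, y k * y l = y l * y k := fun k l => mul_comm _ _
    rw [sum_symmetrize h h_two (fun a k l => B i j a * A a k l) (fun a k l => B i k a * A j a l)
      _ hz, sum_symmetrize h h_two (fun a k l => B j i a * A a k l)
      (fun a k l => B j k a * A i a l) _ hz]
    simp only [hBA i j]
  have rBBAC : ∑ k, ∑ l, (∑ a, B i j a * B a k l) * (y k * w l)
        + ∑ k, ∑ l, (∑ b, B i k b * B j b l) * (y k * w l)
        + ∑ k, ∑ l, (∑ b, C i k b * A j b l) * (w k * y l)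
      = ∑ k, ∑ l, (∑ a, B j i a * B a k l) * (y k * w l)
        + ∑ k, ∑ l, (∑ b, B j k b * B i b l) * (y k * w l)
        + ∑ k, ∑ l, (∑ b, C j k b * A i b l) * (w k * y l) := by
    rw [Finset.sum_comm (f := fun k l => (∑ b, C i k b * A j b l) * (w k * y l)),
      Finset.sum_comm (f := fun k l => (∑ b, C j k b * A i b l) * (w k * y l))]
    simp only [← Finset.sum_add_distrib, mul_comm (w _), ← add_mul, hBBAC i j]
  have rBC : ∀ z : I → I → R, (∀ k l, z k l = z l k) →
      h * (∑ k, ∑ l, (∑ a, B i j a * C a k l) * z k l)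
        + ∑ k, ∑ l, (∑ b, C i k b * B j b l) * z k l
      = h * (∑ k, ∑ l, (∑ a, B j i a * C a k l) * z k l)
        + ∑ k, ∑ l, (∑ b, C j k b * B i b l) * z k l := by
    intro z hz
    rw [sum_symmetrize h h_two (fun a k l => B i j a * C a k l) (fun a k l => C i k a * B j a l)
      _ hz, sum_symmetrize h h_two (fun a k l => B j i a * C a k l)
      (fun a k l => C j k a * B i a l) _ hz]
    simp only [hBC i j]
  have rBC' := rBC (fun k l => t * Q k l + w k * w l) fun k l => by rw [hQs k l]; ring
  have split : ∀ i j, ∑ k, ∑ l, (∑ b, C i k b * B j b l) * (t * Q k l + w k * w l)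
      = t * (∑ k, ∑ l, (∑ b, C i k b * B j b l) * Q l k)
        + ∑ k, ∑ l, (∑ b, C i k b * B j b l) * (w k * w l) := by
    intro i j
    rw [Finset.mul_sum, ← Finset.sum_add_distrib]
    refine Finset.sum_congr rfl fun k _ => ?_
    rw [Finset.mul_sum, ← Finset.sum_add_distrib]
    exact Finset.sum_congr rfl fun l _ => by rw [hQs k l]; ring
  simp only [split] at rBC'
  rw [T1 i j, T1 j i, T2 i j, T2 j i, T3 i j, T3 j i, sQQ, sK, sμ]
  linear_combination rBA + rBBAC + rBC' + t ^ 2 * hD i j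
    + t * (∑ k, ∑ l, (∑ b, C i k b * B j b l) * Q l k
      - ∑ k, ∑ l, (∑ b, C j k b * B i b l) * Q l k) * h_two

end TensorIdentity

section GeneratingSeries

open MvPolynomial

theorem pderiv_comm {I : Type*} (i j : I) (p : MvPolynomial I ℂ) :
    pderiv i (pderiv j p) = pderiv j (pderiv i p) := by
  classical
  have h : ⁅(pderiv i : Derivation ℂ (MvPolynomial I ℂ) (MvPolynomial I ℂ)),
      (pderiv j : Derivation ℂ (MvPolynomial I ℂ) (MvPolynomial I ℂ))⁆ = 0 := by
    refine MvPolynomial.derivation_ext fun k => ?_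
    rw [Derivation.commutator_apply, pderiv_X, pderiv_X, Pi.single_apply, Pi.single_apply]
    split_ifs <;> simp
  have h' := DFunLike.congr_fun h p
  rwa [Derivation.commutator_apply, Derivation.zero_apply, sub_eq_zero] at h'

/-- Coefficientwise partial derivative of a power series over a polynomial ring. -/
noncomputable def coeffPderiv {I : Type*} (i : I) :
    Derivation ℂ (PowerSeries (MvPolynomial I ℂ)) (PowerSeries (MvPolynomial I ℂ)) :=
  Derivation.mk'
    { toFun := fun f => PowerSeries.mk fun k => pderiv i (PowerSeries.coeff k f)
      map_add' := fun f g => by ext1 k; simp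
      map_smul' := fun c f => by ext1 k; simp }
    fun f g => by
      ext1 k
      simp only [LinearMap.coe_mk, AddHom.coe_mk, PowerSeries.coeff_mk, smul_eq_mul, map_add,
        PowerSeries.coeff_mul, map_sum, Derivation.leibniz, Finset.sum_add_distrib]
      rw [← Finset.Nat.sum_antidiagonal_swap (n := k)
        (f := fun p => PowerSeries.coeff p.1 g * _)]
      rfl

theorem coeff_coeffPderiv {I : Type*} (i : I) (k : ℕ) (f : PowerSeries (MvPolynomial I ℂ)) :
    PowerSeries.coeff k (coeffPderiv i f) = pderiv i (PowerSeries.coeff k f) :=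
  PowerSeries.coeff_mk k fun k => pderiv i (PowerSeries.coeff k f)

theorem coeffPderiv_comm {I : Type*} (i j : I) (f : PowerSeries (MvPolynomial I ℂ)) :
    coeffPderiv i (coeffPderiv j f) = coeffPderiv j (coeffPderiv i f) := by
  ext1 k
  simp only [coeff_coeffPderiv]
  exact pderiv_comm _ _ _

theorem coeffPderiv_X {I : Type*} (i : I) :
    coeffPderiv i (PowerSeries.X : PowerSeries (MvPolynomial I ℂ)) = 0 := by
  ext1 k
  rw [coeff_coeffPderiv, PowerSeries.coeff_X]
  split_ifs <;> simp

theorem coeffPderiv_C_X {I : Type*} [DecidableEq I] (i j : I) :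
    coeffPderiv i (PowerSeries.C (MvPolynomial.X j : MvPolynomial I ℂ)) = if i = j then 1 else 0 := by
  ext1 k
  rw [coeff_coeffPderiv, PowerSeries.coeff_C]
  by_cases hk : k = 0 <;> by_cases hij : i = j <;>
    simp [hk, hij, PowerSeries.coeff_one, pderiv_X, eq_comm]

theorem X_pow_dvd_coeffPderiv {I : Type*} (i : I) (n : ℕ) (f : PowerSeries (MvPolynomial I ℂ))
    (hf : (PowerSeries.X : PowerSeries (MvPolynomial I ℂ)) ^ n ∣ f) :
    (PowerSeries.X : PowerSeries (MvPolynomial I ℂ)) ^ n ∣ coeffPderiv i f := by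
  rw [PowerSeries.X_pow_dvd_iff] at hf ⊢
  intro m hm
  rw [coeff_coeffPderiv, hf m hm, map_zero]

variable {I : Type*} [Fintype I] (A B C : I → I → I → ℂ) (D : I → ℂ)

/-- The generating polynomials of the amplitudes: the degree `n` part of `trPoly A B C D k i`
collects the amplitudes `F_{g,n+1}(i, …)` with `2g + n = k`. -/
noncomputable def trPoly : ℕ → I → MvPolynomial I ℂ
  | 0, _ => 0
  | k + 1, i =>
    (if k = 1 then (1 / 2 : ℂ) • ∑ a, ∑ b, A i a b • (X a * X b) + MvPolynomial.C (D i) else 0)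
      + ∑ a, ∑ b, B i a b • (X a * trPoly k b)
      + (1 / 2 : ℂ) • ∑ a, ∑ b, C i a b • (pderiv a (trPoly k b)
          + ∑ p : Fin k, trPoly (p + 1) a * trPoly (k - p) b)
  termination_by k => k

/-- The generating series of the amplitudes with first index `i`. -/
noncomputable def trSeries (i : I) : PowerSeries (MvPolynomial I ℂ) :=
  PowerSeries.mk fun k => trPoly A B C D k i

theorem sum_antidiagonal_trPoly (k : ℕ) (a b : I) :
    ∑ p ∈ Finset.HasAntidiagonal.antidiagonal (k + 1), trPoly A B C D p.1 a * trPoly A B C D p.2 b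
      = ∑ p : Fin k, trPoly A B C D (p + 1) a * trPoly A B C D (k - p) b := by
  have h0 : ∀ i, trPoly A B C D 0 i = 0 := fun i => by rw [trPoly]
  rw [Finset.Nat.sum_antidiagonal_eq_sum_range_succ
    (fun p q => trPoly A B C D p a * trPoly A B C D q b), Finset.sum_range_succ,
    Finset.sum_range_succ', Finset.sum_range]
  simp [h0]

theorem trSeries_eq (i : I) :
    trSeries A B C D i
      = algebraMap ℂ _ (1 / 2) * (∑ a, ∑ b, algebraMap ℂ _ (A i a b)
          * ((PowerSeries.X * PowerSeries.C (X a)) * (PowerSeries.X * PowerSeries.C (X b))))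
        + ∑ a, ∑ b, algebraMap ℂ _ (B i a b)
          * ((PowerSeries.X * PowerSeries.C (X a)) * trSeries A B C D b)
        + algebraMap ℂ _ (1 / 2) * (∑ a, ∑ b, algebraMap ℂ _ (C i a b)
          * (PowerSeries.X * coeffPderiv a (trSeries A B C D b)
            + trSeries A B C D a * trSeries A B C D b))
        + PowerSeries.X ^ 2 * algebraMap ℂ _ (D i) := by
  have h0 : ∀ i, trPoly A B C D 0 i = 0 := fun i => by rw [trPoly]
  have hX : ∀ a b : I, (PowerSeries.X * PowerSeries.C (X a : MvPolynomial I ℂ))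
      * (PowerSeries.X * PowerSeries.C (X b)) = PowerSeries.X ^ 2 * PowerSeries.C (X a * X b) := by
    intro a b
    rw [map_mul]
    ring
  have hD : algebraMap ℂ (PowerSeries (MvPolynomial I ℂ)) (D i)
      = PowerSeries.C (MvPolynomial.C (D i)) := PowerSeries.algebraMap_apply
  have hs : ∀ (k : ℕ) (c : ℂ) (f : PowerSeries (MvPolynomial I ℂ)),
      PowerSeries.coeff k (c • f) = c • PowerSeries.coeff k f := fun k c f => by simp
  simp only [hX, hD, ← Algebra.smul_def]
  ext1 k
  rcases k with _ | k
  · simp [trSeries, h0]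
  · simp only [map_add, hs, map_sum, mul_assoc, PowerSeries.coeff_succ_X_mul,
      coeff_coeffPderiv, PowerSeries.coeff_C_mul, PowerSeries.coeff_X_pow_mul',
      PowerSeries.coeff_C]
    simp only [PowerSeries.coeff_mul, trSeries, PowerSeries.coeff_mk, sum_antidiagonal_trPoly]
    rw [trPoly]
    rcases eq_or_ne k 1 with rfl | hk
    · simp
      ring
    · have hk' : ¬ (2 ≤ k + 1 ∧ k + 1 - 2 = 0) := by omega
      rw [if_neg hk]
      split_ifs <;> simp_all

theorem exists_trSeries_eq_X_mul (i : I) : ∃ η, trSeries A B C D i = PowerSeries.X * η := by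
  have h0 : PowerSeries.X ∣ trSeries A B C D i := by
    rw [PowerSeries.X_dvd_iff, ← PowerSeries.coeff_zero_eq_constantCoeff_apply, trSeries,
      PowerSeries.coeff_mk, trPoly]
  exact h0

variable {A B C D}

theorem coeffPderiv_trSeries (hA : ∀ i j k, A i j k = A i k j) (hC : ∀ i j k, C i j k = C i k j)
    (i j : I) :
    coeffPderiv j (trSeries A B C D i)
      = PowerSeries.X * (∑ l, algebraMap ℂ _ (A i j l) * (PowerSeries.X * PowerSeries.C (X l))
          + ∑ l, algebraMap ℂ _ (B i j l) * trSeries A B C D l)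
        + ∑ b, (∑ k, algebraMap ℂ _ (B i k b) * (PowerSeries.X * PowerSeries.C (X k))
            + ∑ k, algebraMap ℂ _ (C i k b) * trSeries A B C D k)
          * coeffPderiv j (trSeries A B C D b)
        + algebraMap ℂ _ (1 / 2) * PowerSeries.X * ∑ a, ∑ b, algebraMap ℂ _ (C i a b)
          * coeffPderiv j (coeffPderiv a (trSeries A B C D b)) := by
  classical
  have h_two : algebraMap ℂ (PowerSeries (MvPolynomial I ℂ)) (1 / 2) + algebraMap ℂ _ (1 / 2) = 1 := by
    rw [← map_add]
    norm_num
  have eA : ∑ x, algebraMap ℂ _ (A i x j) * (PowerSeries.X * PowerSeries.C (X x))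
      = ∑ x, algebraMap ℂ _ (A i j x)
        * (PowerSeries.X * PowerSeries.C (X x : MvPolynomial I ℂ)) := by
    simp only [hA i _ j]
  have eB : ∑ b, (∑ k, algebraMap ℂ _ (B i k b) * (PowerSeries.X * PowerSeries.C (X k)))
        * coeffPderiv j (trSeries A B C D b)
      = ∑ a, ∑ b, algebraMap ℂ _ (B i a b) * ((PowerSeries.X * PowerSeries.C (X a))
        * coeffPderiv j (trSeries A B C D b)) := by
    simp only [Finset.sum_mul, mul_assoc]
    exact Finset.sum_comm
  have eC : ∑ b, (∑ k, algebraMap ℂ _ (C i k b) * trSeries A B C D k)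
        * coeffPderiv j (trSeries A B C D b)
      = ∑ a, ∑ b, algebraMap ℂ _ (C i a b) * (trSeries A B C D a
        * coeffPderiv j (trSeries A B C D b)) := by
    simp only [Finset.sum_mul, mul_assoc]
    exact Finset.sum_comm
  have eC' : ∑ a, ∑ b, algebraMap ℂ _ (C i a b) * (trSeries A B C D b
        * coeffPderiv j (trSeries A B C D a))
      = ∑ a, ∑ b, algebraMap ℂ _ (C i a b) * (trSeries A B C D a
        * coeffPderiv j (trSeries A B C D b)) := by
    rw [Finset.sum_comm]
    simp only [fun a b => hC i a b]
  have dy : ∀ a, coeffPderiv j (PowerSeries.X * PowerSeries.C (X a : MvPolynomial I ℂ))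
      = if j = a then PowerSeries.X else 0 := by
    intro a
    rw [Derivation.leibniz, coeffPderiv_X, coeffPderiv_C_X, smul_zero, add_zero, smul_eq_mul,
      mul_ite, mul_one, mul_zero]
  simp only [add_mul, Finset.sum_add_distrib]
  rw [eB, eC]
  conv_lhs => rw [trSeries_eq]
  generalize hy : (fun a : I => (PowerSeries.X * PowerSeries.C (X a : MvPolynomial I ℂ))) = y at *
  simp only [funext_iff] at hy
  simp only [hy] at *
  simp only [map_add, map_sum, Derivation.leibniz, Derivation.map_algebraMap, smul_eq_mul, dy,
    coeffPderiv_X, mul_zero, add_zero, pow_two, mul_add, Finset.sum_add_distrib,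
    mul_ite, Finset.sum_ite_eq, Finset.sum_ite_irrel, Finset.sum_const_zero, Finset.mem_univ,
    if_true, eC']
  simp only [mul_comm (y _) PowerSeries.X, mul_comm (trSeries _ _ _ _ _) PowerSeries.X,
    mul_left_comm _ (PowerSeries.X : PowerSeries (MvPolynomial I ℂ)), ← Finset.mul_sum, eA]
  linear_combination (PowerSeries.X * (∑ l, algebraMap ℂ _ (A i j l) * y l)
    + ∑ a, ∑ b, algebraMap ℂ _ (C i a b) * (trSeries A B C D a
        * coeffPderiv j (trSeries A B C D b))) * h_two

theorem coeffPderiv_coeffPderiv_trSeries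
    (hA : ∀ i j k, A i j k = A i k j) (hC : ∀ i j k, C i j k = C i k j)
    {μ : I → I → PowerSeries (MvPolynomial I ℂ)}
    (hμ : ∀ i b, PowerSeries.X * μ i b
      = ∑ k, algebraMap ℂ _ (B i k b) * (PowerSeries.X * PowerSeries.C (X k))
        + ∑ k, algebraMap ℂ _ (C i k b) * trSeries A B C D k)
    (j b a : I) :
    coeffPderiv a (coeffPderiv b (trSeries A B C D j))
      = PowerSeries.X * (PowerSeries.X * algebraMap ℂ _ (A j b a)
          + ∑ c, algebraMap ℂ _ (B j b c) * coeffPderiv a (trSeries A B C D c))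
        + ∑ c, (PowerSeries.X * algebraMap ℂ _ (B j a c)
          + ∑ e, algebraMap ℂ _ (C j e c) * coeffPderiv a (trSeries A B C D e))
          * coeffPderiv b (trSeries A B C D c)
        + ∑ c, PowerSeries.X * μ j c * coeffPderiv a (coeffPderiv b (trSeries A B C D c))
        + algebraMap ℂ _ (1 / 2) * PowerSeries.X * ∑ c, ∑ d, algebraMap ℂ _ (C j c d)
          * coeffPderiv a (coeffPderiv b (coeffPderiv c (trSeries A B C D d))) := by
  classical
  have hQ := coeffPderiv_trSeries (D := D) hA hC (B := B)
  simp only [← hμ] at hQ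
  have dμ : ∀ a j c, coeffPderiv a (PowerSeries.X * μ j c)
      = PowerSeries.X * algebraMap ℂ _ (B j a c)
        + ∑ e, algebraMap ℂ _ (C j e c) * coeffPderiv a (trSeries A B C D e) := by
    intro a j c
    simp [hμ, Derivation.leibniz, coeffPderiv_X, coeffPderiv_C_X, mul_comm]
  have dX : ∀ f, coeffPderiv a (PowerSeries.X * f) = PowerSeries.X * coeffPderiv a f :=
    fun f => by simp [Derivation.leibniz, coeffPderiv_X]
  have dalg : ∀ (z : ℂ) f, coeffPderiv a (algebraMap ℂ _ z * f)
      = algebraMap ℂ _ z * coeffPderiv a f :=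
    fun z f => by simp [Derivation.leibniz]
  have dμf : ∀ c f, coeffPderiv a (PowerSeries.X * μ j c * f)
      = (PowerSeries.X * algebraMap ℂ _ (B j a c)
        + ∑ e, algebraMap ℂ _ (C j e c) * coeffPderiv a (trSeries A B C D e)) * f
        + PowerSeries.X * μ j c * coeffPderiv a f := fun c f => by
    rw [Derivation.leibniz, dμ, smul_eq_mul, smul_eq_mul, mul_comm f, add_comm]
  conv_lhs => rw [hQ j b]
  simp only [map_add, map_sum, dμf, dX, dalg, coeffPderiv_C_X, Finset.sum_add_distrib,
    mul_assoc (algebraMap ℂ (PowerSeries (MvPolynomial I ℂ)) (1 / 2)), mul_ite, mul_one,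
    mul_zero, Finset.sum_ite_eq, Finset.mem_univ, if_true]
  ring

theorem map_recursion_derivative_symm
    (hA : ∀ i j k, A i j k = A i k j) (hC : ∀ i j k, C i j k = C i k j)
    (hBBAC : RelBBAC A B C) (hBC : RelBC B C) (hBA : RelBA A B) (hD : RelD A B C D)
    {μ : I → I → PowerSeries (MvPolynomial I ℂ)}
    (hμ : ∀ i b, PowerSeries.X * μ i b
      = ∑ k, algebraMap ℂ _ (B i k b) * (PowerSeries.X * PowerSeries.C (X k))
        + ∑ k, algebraMap ℂ _ (C i k b) * trSeries A B C D k)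
    {S : Type*} [CommRing S] (φ : PowerSeries (MvPolynomial I ℂ) →+* S)
    (hs1 : ∀ a b, φ (coeffPderiv b (trSeries A B C D a))
      = φ (coeffPderiv a (trSeries A B C D b)))
    (hs2 : ∀ c a b, φ (coeffPderiv c (coeffPderiv b (trSeries A B C D a)))
      = φ (coeffPderiv c (coeffPderiv a (trSeries A B C D b))))
    (hs3 : ∀ d c a b, φ (coeffPderiv d (coeffPderiv c (coeffPderiv b (trSeries A B C D a))))
      = φ (coeffPderiv d (coeffPderiv c (coeffPderiv a (trSeries A B C D b)))))
    (i j : I) :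
    φ (∑ a, algebraMap ℂ _ (B i j a) * trSeries A B C D a
        + ∑ b, μ i b * coeffPderiv j (trSeries A B C D b)
        + algebraMap ℂ _ (1 / 2) * ∑ a, ∑ b, algebraMap ℂ _ (C i a b)
          * coeffPderiv j (coeffPderiv a (trSeries A B C D b)))
      = φ (∑ a, algebraMap ℂ _ (B j i a) * trSeries A B C D a
        + ∑ b, μ j b * coeffPderiv i (trSeries A B C D b)
        + algebraMap ℂ _ (1 / 2) * ∑ a, ∑ b, algebraMap ℂ _ (C j a b)
          * coeffPderiv i (coeffPderiv a (trSeries A B C D b))) := by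
  have hQ := coeffPderiv_trSeries (D := D) hA hC (B := B)
  simp only [← hμ] at hQ
  have hH := coeffPderiv_coeffPderiv_trSeries (D := D) hA hC hμ
  have hw := trSeries_eq A B C D
  have key := recursion_derivative_symm
    (fun i j k => φ (algebraMap ℂ _ (A i j k)))
    (fun i j k => φ (algebraMap ℂ _ (B i j k)))
    (fun i j k => φ (algebraMap ℂ _ (C i j k)))
    (fun i => φ (algebraMap ℂ _ (D i)))
    (φ (algebraMap ℂ _ (1 / 2))) (φ PowerSeries.X)
    (by rw [← map_add, ← map_add]; norm_num)
    (fun i j k => by rw [hC])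
    (fun i j k l => by
      have := congrArg (fun z => φ (algebraMap ℂ _ z)) (hBBAC i j k l)
      simpa only [map_add, map_sum, map_mul] using this)
    (fun i j k l => by
      have := congrArg (fun z => φ (algebraMap ℂ _ z)) (hBC i j k l)
      simpa only [map_add, map_sum, map_mul] using this)
    (fun i j k l => by
      have := congrArg (fun z => φ (algebraMap ℂ _ z)) (hBA i j k l)
      simpa only [map_add, map_sum, map_mul] using this)
    (fun i j => by
      have := congrArg (fun z => φ (algebraMap ℂ _ z)) (hD i j)
      simpa only [map_add, map_sum, map_mul] using this)
    (fun i j k => by rw [hA])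
    (fun k => φ (PowerSeries.X * PowerSeries.C (X k)))
    (fun k => φ (trSeries A B C D k))
    (fun i b => φ (μ i b))
    (fun i j => φ (coeffPderiv j (trSeries A B C D i)))
    (fun i j k => φ (coeffPderiv k (coeffPderiv j (trSeries A B C D i))))
    (fun i j k l => φ
      (coeffPderiv l (coeffPderiv k (coeffPderiv j (trSeries A B C D i)))))
    (fun i b => by
      simpa only [map_add, map_sum, map_mul] using congrArg φ (hμ i b))
    (fun i => by
      refine (congrArg φ (hw i)).trans ?_
      have e : ∑ a, ∑ b, φ (algebraMap ℂ _ (C i a b)) * (φ PowerSeries.X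
            * φ (coeffPderiv a (trSeries A B C D b)) + φ (trSeries A B C D a)
              * φ (trSeries A B C D b))
          = ∑ a, ∑ b, φ (algebraMap ℂ _ (C i a b)) * (φ PowerSeries.X
            * φ (coeffPderiv b (trSeries A B C D a)) + φ (trSeries A B C D a)
              * φ (trSeries A B C D b)) :=
        Finset.sum_congr rfl fun a _ => Finset.sum_congr rfl fun b _ => by rw [hs1 b a]
      simp only [map_add, map_sum, map_mul, map_pow, e])
    (fun i j => by
      have := congrArg φ (hQ i j)
      simp only [map_add, map_sum, map_mul] at this ⊢
      exact this)
    (fun j b a => by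
      have := congrArg φ (hH j b a)
      simp only [map_add, map_sum, map_mul] at this ⊢
      exact this)
    hs1 (fun a b c => hs2 c a b) (fun a b c => by rw [coeffPderiv_comm]) (fun a b c d => by
      rw [coeffPderiv_comm c b, coeffPderiv_comm d b, coeffPderiv_comm a d]
      exact hs3 b d a c) i j
  simp only [map_add, map_sum, map_mul]
  exact key

theorem X_pow_dvd_coeffPderiv_sub
    (hA : ∀ i j k, A i j k = A i k j) (hC : ∀ i j k, C i j k = C i k j)
    (hSymA : ∀ i j k, A i j k = A j i k)
    (hBBAC : RelBBAC A B C) (hBC : RelBC B C) (hBA : RelBA A B) (hD : RelD A B C D) (N : ℕ) :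
    ∀ i j, (PowerSeries.X : PowerSeries (MvPolynomial I ℂ)) ^ N
      ∣ coeffPderiv j (trSeries A B C D i) - coeffPderiv i (trSeries A B C D j) := by
  induction N with
  | zero => intro i j; simp
  | succ N ih =>
    intro i j
    choose η hη using exists_trSeries_eq_X_mul A B C D
    obtain ⟨μ, hμ⟩ : ∃ μ : I → I → PowerSeries (MvPolynomial I ℂ), ∀ i b,
        PowerSeries.X * μ i b
          = ∑ k, algebraMap ℂ _ (B i k b) * (PowerSeries.X * PowerSeries.C (X k))
            + ∑ k, algebraMap ℂ _ (C i k b) * trSeries A B C D k := by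
      refine ⟨fun i b => ∑ k, algebraMap ℂ _ (B i k b) * PowerSeries.C (X k)
        + ∑ k, algebraMap ℂ _ (C i k b) * η k, fun i b => ?_⟩
      simp only [hη, mul_add, Finset.mul_sum, mul_left_comm]
    have hQ := coeffPderiv_trSeries (D := D) hA hC (B := B)
    simp only [← hμ] at hQ
    set J : Ideal (PowerSeries (MvPolynomial I ℂ)) := Ideal.span {PowerSeries.X ^ N}
    have hJ : ∀ f g, (PowerSeries.X : PowerSeries (MvPolynomial I ℂ)) ^ N ∣ f - g →
        Ideal.Quotient.mk J f = Ideal.Quotient.mk J g := fun f g hfg =>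
      Ideal.Quotient.eq.2 (Ideal.mem_span_singleton.2 hfg)
    have dvd_d : ∀ a f g, (PowerSeries.X : PowerSeries (MvPolynomial I ℂ)) ^ N ∣ f - g →
        (PowerSeries.X : PowerSeries (MvPolynomial I ℂ)) ^ N
          ∣ coeffPderiv a f - coeffPderiv a g := fun a f g hfg => by
      rw [← map_sub]
      exact X_pow_dvd_coeffPderiv a N _ hfg
    have key := map_recursion_derivative_symm hA hC hBBAC hBC hBA hD hμ (Ideal.Quotient.mk J)
      (fun a b => hJ _ _ (ih a b)) (fun c a b => hJ _ _ (dvd_d c _ _ (ih a b)))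
      (fun d c a b => hJ _ _ (dvd_d d _ _ (dvd_d c _ _ (ih a b)))) i j
    have key' := Ideal.mem_span_singleton.1 (Ideal.Quotient.eq.1 key)
    rw [pow_succ']
    refine (mul_dvd_mul_left PowerSeries.X key').trans (dvd_of_eq ?_)
    rw [hQ i j, hQ j i]
    have hs : ∑ l, algebraMap ℂ (PowerSeries (MvPolynomial I ℂ)) (A i j l)
        * (PowerSeries.X * PowerSeries.C (X l))
        = ∑ l, algebraMap ℂ _ (A j i l) * (PowerSeries.X * PowerSeries.C (X l)) := by
      simp only [hSymA i j]
    rw [hs]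
    simp only [mul_assoc PowerSeries.X (μ _ _), ← Finset.mul_sum]
    ring

theorem pderiv_trPoly_symm
    (hA : ∀ i j k, A i j k = A i k j) (hC : ∀ i j k, C i j k = C i k j)
    (hSymA : ∀ i j k, A i j k = A j i k)
    (hBBAC : RelBBAC A B C) (hBC : RelBC B C) (hBA : RelBA A B) (hD : RelD A B C D)
    (k : ℕ) (i j : I) :
    pderiv j (trPoly A B C D k i) = pderiv i (trPoly A B C D k j) := by
  have h := X_pow_dvd_coeffPderiv_sub hA hC hSymA hBBAC hBC hBA hD (k + 1) i j
  rw [PowerSeries.X_pow_dvd_iff] at h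
  have h' := h k (Nat.lt_succ_self k)
  rw [map_sub, coeff_coeffPderiv, coeff_coeffPderiv, sub_eq_zero, trSeries, trSeries,
    PowerSeries.coeff_mk, PowerSeries.coeff_mk] at h'
  exact h'

end GeneratingSeries

section IteratedDerivatives

open MvPolynomial

instance {I : Type*} : LeftCommutative fun (a : I) (L : MvPolynomial I ℂ →ₗ[ℂ] MvPolynomial I ℂ) =>
    (pderiv a : Derivation ℂ (MvPolynomial I ℂ) (MvPolynomial I ℂ)).toLinearMap ∘ₗ L :=
  ⟨fun a b _ => LinearMap.ext fun _ => pderiv_comm a b _⟩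

/-- Iterated partial derivative along a multiset of indices. -/
noncomputable def iterPderiv {I : Type*} (s : Multiset I) :
    MvPolynomial I ℂ →ₗ[ℂ] MvPolynomial I ℂ :=
  s.foldr (fun a L =>
    (pderiv a : Derivation ℂ (MvPolynomial I ℂ) (MvPolynomial I ℂ)).toLinearMap ∘ₗ L)
    LinearMap.id

/-- The value at the origin of an iterated partial derivative. -/
noncomputable def taylorCoeff {I : Type*} (s : Multiset I) : MvPolynomial I ℂ →ₗ[ℂ] ℂ :=
  (aeval (fun _ => 0) : MvPolynomial I ℂ →ₐ[ℂ] ℂ).toLinearMap ∘ₗ iterPderiv s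

theorem iterPderiv_zero {I : Type*} (p : MvPolynomial I ℂ) : iterPderiv 0 p = p := rfl

theorem iterPderiv_cons {I : Type*} (a : I) (s : Multiset I) (p : MvPolynomial I ℂ) :
    iterPderiv (a ::ₘ s) p = pderiv a (iterPderiv s p) := by
  rw [iterPderiv, Multiset.foldr_cons]
  rfl

theorem iterPderiv_pderiv {I : Type*} (a : I) (s : Multiset I) (p : MvPolynomial I ℂ) :
    iterPderiv s (pderiv a p) = iterPderiv (a ::ₘ s) p := by
  induction s using Multiset.induction_on with
  | empty => rfl
  | cons b s ih =>
    rw [iterPderiv_cons, ih, iterPderiv_cons, iterPderiv_cons, iterPderiv_cons, pderiv_comm]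

theorem taylorCoeff_apply {I : Type*} (s : Multiset I) (p : MvPolynomial I ℂ) :
    taylorCoeff s p = aeval (fun _ => (0 : ℂ)) (iterPderiv s p) := rfl

theorem taylorCoeff_pderiv {I : Type*} (a : I) (s : Multiset I) (p : MvPolynomial I ℂ) :
    taylorCoeff s (pderiv a p) = taylorCoeff (a ::ₘ s) p := by
  rw [taylorCoeff_apply, taylorCoeff_apply, iterPderiv_pderiv]

theorem iterPderiv_mul {I J : Type*} [DecidableEq J] (w : J → I) (S : Finset J)
    (f g : MvPolynomial I ℂ) :
    iterPderiv (S.val.map w) (f * g)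
      = ∑ T ∈ S.powerset, iterPderiv (T.val.map w) f * iterPderiv ((S \ T).val.map w) g := by
  induction S using Finset.induction_on with
  | empty => simp [iterPderiv_zero]
  | insert c S hc ih =>
    rw [Finset.insert_val_of_notMem hc, Multiset.map_cons, iterPderiv_cons, ih, map_sum,
      Finset.sum_powerset_insert hc, ← Finset.sum_add_distrib]
    refine Finset.sum_congr rfl fun T hT => ?_
    have hcT : c ∉ T := fun h => hc (Finset.mem_powerset.1 hT h)
    have h1 : insert c S \ T = insert c (S \ T) := Finset.insert_sdiff_of_notMem _ hcT
    have h2 : insert c S \ insert c T = S \ T := by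
      rw [Finset.insert_sdiff_insert, Finset.sdiff_insert_of_notMem hc]
    rw [h1, h2, Finset.insert_val_of_notMem (fun h => hc (Finset.mem_sdiff.1 h).1),
      Finset.insert_val_of_notMem hcT, Multiset.map_cons, Multiset.map_cons, iterPderiv_cons,
      iterPderiv_cons, Derivation.leibniz, smul_eq_mul, smul_eq_mul]
    ring

theorem taylorCoeff_mul {I J : Type*} [DecidableEq J] (w : J → I) (S : Finset J)
    (f g : MvPolynomial I ℂ) :
    taylorCoeff (S.val.map w) (f * g)
      = ∑ T ∈ S.powerset, taylorCoeff (T.val.map w) f * taylorCoeff ((S \ T).val.map w) g := by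
  simp only [taylorCoeff_apply, iterPderiv_mul, map_sum, map_mul]

theorem iterPderiv_X_mul {I J : Type*} [DecidableEq I] [DecidableEq J] (w : J → I) (S : Finset J)
    (a : I) (f : MvPolynomial I ℂ) :
    iterPderiv (S.val.map w) (X a * f) = X a * iterPderiv (S.val.map w) f
      + ∑ m ∈ S, if w m = a then iterPderiv ((S.erase m).val.map w) f else 0 := by
  induction S using Finset.induction_on with
  | empty => simp [iterPderiv_zero]
  | insert c S hc ih =>
    rw [Finset.sum_insert hc, Finset.erase_insert hc, Finset.insert_val_of_notMem hc,
      Multiset.map_cons, iterPderiv_cons, ih, map_add, Derivation.leibniz, pderiv_X, map_sum,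
      iterPderiv_cons]
    have h : ∀ m ∈ S, (pderiv (w c) (if w m = a then iterPderiv ((S.erase m).val.map w) f else 0))
        = if w m = a then iterPderiv (((insert c S).erase m).val.map w) f else 0 := by
      intro m hm
      have hmc : c ≠ m := fun h => hc (h ▸ hm)
      rw [Finset.erase_insert_of_ne hmc, Finset.insert_val_of_notMem
        (fun h => hc (Finset.mem_of_mem_erase h)), Multiset.map_cons, iterPderiv_cons]
      split_ifs <;> simp
    rw [Finset.sum_congr rfl h]
    by_cases hca : w c = a
    · subst hca
      simp
      ring
    · simp [hca]

theorem taylorCoeff_X_mul {I J : Type*} [DecidableEq I] [DecidableEq J] (w : J → I) (S : Finset J)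
    (a : I) (f : MvPolynomial I ℂ) :
    taylorCoeff (S.val.map w) (X a * f)
      = ∑ m ∈ S, if w m = a then taylorCoeff ((S.erase m).val.map w) f else 0 := by
  simp only [taylorCoeff_apply, iterPderiv_X_mul, map_add, map_mul, aeval_X, zero_mul, zero_add,
    map_sum]
  exact Finset.sum_congr rfl fun m _ => by split_ifs <;> simp

/-- Polynomials all of whose monomials have degree at most `k` and of the same parity as `k`. -/
noncomputable def genusSubmodule (I : Type*) (k : ℕ) : Submodule ℂ (MvPolynomial I ℂ) where
  carrier := {f | ∀ s, taylorCoeff s f ≠ 0 → ∃ g, k = 2 * g + s.card}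
  zero_mem' := fun s hs => absurd (map_zero _) hs
  add_mem' := fun {f f'} hf hf' s hs => by
    by_cases h : taylorCoeff s f = 0
    · exact hf' s fun h' => hs (by rw [map_add, h, h', add_zero])
    · exact hf s h
  smul_mem' := fun c f hf s hs => hf s fun h => hs (by rw [map_smul, h, smul_zero])

theorem mul_mem_genusSubmodule {I : Type*} {p q k : ℕ} {f f' : MvPolynomial I ℂ}
    (hf : f ∈ genusSubmodule I p) (hf' : f' ∈ genusSubmodule I q) (hk : p + q = k) :
    f * f' ∈ genusSubmodule I k := by
  classical
  intro s hs
  rw [← Multiset.map_univ_coe s, taylorCoeff_mul] at hs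
  obtain ⟨T, hT, hne⟩ := Finset.exists_ne_zero_of_sum_ne_zero hs
  obtain ⟨g, hg⟩ := hf _ (left_ne_zero_of_mul hne)
  obtain ⟨g', hg'⟩ := hf' _ (right_ne_zero_of_mul hne)
  rw [Multiset.card_map, Finset.card_val] at hg hg'
  have hc := Finset.card_sdiff_add_card_eq_card (Finset.mem_powerset.1 hT)
  rw [Finset.card_univ, Multiset.card_coe] at hc
  exact ⟨g + g', by omega⟩

theorem pderiv_mem_genusSubmodule {I : Type*} {k : ℕ} {f : MvPolynomial I ℂ}
    (hf : f ∈ genusSubmodule I k) (a : I) : pderiv a f ∈ genusSubmodule I (k + 1) := by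
  intro s hs
  rw [taylorCoeff_pderiv] at hs
  obtain ⟨g, hg⟩ := hf _ hs
  rw [Multiset.card_cons] at hg
  exact ⟨g + 1, by omega⟩

theorem C_mem_genusSubmodule {I : Type*} (c : ℂ) : MvPolynomial.C c ∈ genusSubmodule I 2 := by
  intro s hs
  induction s using Multiset.induction_on with
  | empty => exact ⟨1, rfl⟩
  | cons a s _ => simp [← taylorCoeff_pderiv] at hs

theorem X_mem_genusSubmodule {I : Type*} (a : I) : X a ∈ genusSubmodule I 1 := by
  classical
  intro s hs
  induction s using Multiset.induction_on with
  | empty => simp [taylorCoeff_apply, iterPderiv_zero] at hs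
  | cons b s _ =>
    induction s using Multiset.induction_on with
    | empty => exact ⟨0, rfl⟩
    | cons c s _ =>
      rw [← taylorCoeff_pderiv, ← taylorCoeff_pderiv, pderiv_X, Pi.single_apply] at hs
      split_ifs at hs <;> simp at hs

theorem trPoly_mem_genusSubmodule {I : Type*} [Fintype I] (A B C : I → I → I → ℂ) (D : I → ℂ)
    (k : ℕ) (i : I) : trPoly A B C D k i ∈ genusSubmodule I k := by
  induction k using Nat.strong_induction_on generalizing i with
  | _ k ih =>
    rcases k with _ | k
    · rw [trPoly]
      exact Submodule.zero_mem _
    · rw [trPoly]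
      refine add_mem (add_mem ?_ ?_) ?_
      · split_ifs with hk
        · subst hk
          exact add_mem (Submodule.smul_mem _ _ <| sum_mem fun a _ => sum_mem fun b _ =>
            Submodule.smul_mem _ _ <| mul_mem_genusSubmodule (X_mem_genusSubmodule a)
              (X_mem_genusSubmodule b) rfl) (C_mem_genusSubmodule _)
        · exact Submodule.zero_mem _
      · exact sum_mem fun a _ => sum_mem fun b _ => Submodule.smul_mem _ _ <|
          mul_mem_genusSubmodule (X_mem_genusSubmodule a) (ih k k.lt_succ_self b) (add_comm _ _)
      · exact Submodule.smul_mem _ _ <| sum_mem fun a _ => sum_mem fun b _ =>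
          Submodule.smul_mem _ _ <| add_mem
            (pderiv_mem_genusSubmodule (ih k k.lt_succ_self b) a)
            (sum_mem fun p _ => mul_mem_genusSubmodule (ih _ (by omega) a) (ih _ (by omega) b)
              (by omega))

end IteratedDerivatives

section Amplitudes

open MvPolynomial

theorem val_map_univ_orderIsoOfFin {I : Type*} {n : ℕ} (S : Finset (Fin n)) (w : Fin n → I) :
    (Finset.univ : Finset (Fin S.card)).val.map (fun j => w (S.orderIsoOfFin rfl j).1)
      = S.val.map w := by
  have h : Finset.univ.map (S.orderEmbOfFin rfl).toEmbedding = S := by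
    rw [← Finset.coe_inj]
    simp
  conv_rhs => rw [← h, Finset.map_val, Multiset.map_map]
  rfl

variable {I : Type*} [Fintype I] {A B C : I → I → I → ℂ} {D : I → ℂ}

theorem taylorCoeff_trPoly_succ [DecidableEq I] {n : ℕ} (w : Fin n → I) {k : ℕ} (hk : k ≠ 1)
    (i : I) :
    taylorCoeff (Finset.univ.val.map w) (trPoly A B C D (k + 1) i)
      = ∑ m, ∑ a, B i (w m) a
          * taylorCoeff ((Finset.univ.erase m).val.map w) (trPoly A B C D k a)
        + (1 / 2) * ∑ a, ∑ b, C i a b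
          * (taylorCoeff (a ::ₘ Finset.univ.val.map w) (trPoly A B C D k b)
            + ∑ S : Finset (Fin n), ∑ p ∈ Finset.HasAntidiagonal.antidiagonal (k + 1),
              taylorCoeff (S.val.map w) (trPoly A B C D p.1 a)
                * taylorCoeff (Sᶜ.val.map w) (trPoly A B C D p.2 b)) := by
  rw [trPoly, if_neg hk, zero_add, map_add, map_smul]
  simp only [← sum_antidiagonal_trPoly, map_sum, map_smul, smul_eq_mul, taylorCoeff_X_mul,
    map_add, taylorCoeff_pderiv]
  simp only [taylorCoeff_mul, Finset.powerset_univ, ← Finset.compl_eq_univ_sdiff]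
  congr 1
  · rw [Finset.sum_comm, Finset.sum_comm (s := (Finset.univ : Finset (Fin n)))]
    refine Finset.sum_congr rfl fun b _ => ?_
    simp only [Finset.mul_sum, mul_ite, mul_zero]
    rw [Finset.sum_comm]
    simp only [Finset.sum_ite_eq, Finset.mem_univ, if_true]
  · simp only [Finset.sum_comm (s := Finset.HasAntidiagonal.antidiagonal (k + 1))]

theorem sum_antidiagonal_taylorCoeff (g n : ℕ) (w : Fin n → I) (S : Finset (Fin n)) (a b : I) :
    ∑ p ∈ Finset.HasAntidiagonal.antidiagonal (2 * g + n),
        taylorCoeff (S.val.map w) (trPoly A B C D p.1 a)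
          * taylorCoeff (Sᶜ.val.map w) (trPoly A B C D p.2 b)
      = ∑ h ∈ Finset.range (g + 1),
        taylorCoeff (S.val.map w) (trPoly A B C D (2 * h + S.card) a)
          * taylorCoeff (Sᶜ.val.map w) (trPoly A B C D (2 * (g - h) + Sᶜ.card) b) := by
  symm
  have hc := S.card_add_card_compl
  rw [Fintype.card_fin] at hc
  refine Finset.sum_of_injOn (fun h => (2 * h + S.card, 2 * (g - h) + Sᶜ.card)) ?_ ?_ ?_ ?_
  · intro h _ h' _ hh
    simp only [Prod.mk.injEq] at hh
    omega
  · intro h hh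
    simp only [Finset.coe_range, Set.mem_Iio, Finset.mem_coe,
      Finset.HasAntidiagonal.mem_antidiagonal] at hh ⊢
    omega
  · rintro ⟨p, q⟩ hp hne
    by_contra hpq
    obtain ⟨h, hh⟩ := trPoly_mem_genusSubmodule A B C D _ _ _ (left_ne_zero_of_mul hpq)
    obtain ⟨h', hh'⟩ := trPoly_mem_genusSubmodule A B C D _ _ _ (right_ne_zero_of_mul hpq)
    simp only [Multiset.card_map, Finset.card_val] at hh hh'
    rw [Finset.HasAntidiagonal.mem_antidiagonal] at hp
    simp only at hp
    refine hne ⟨h, ?_, ?_⟩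
    · simp only [Finset.coe_range, Set.mem_Iio]
      omega
    · simp only [Prod.mk.injEq]
      omega
  · exact fun _ _ => rfl

theorem TRF_eq_taylorCoeff (hA : ∀ i j k, A i j k = A i k j)
    (hsymm : ∀ k i j, pderiv j (trPoly A B C D k i) = pderiv i (trPoly A B C D k j))
    (g n : ℕ) (v : Fin (n + 1) → I) :
    TRF A B C D g (n + 1) v
      = taylorCoeff (Finset.univ.val.map (Fin.tail v)) (trPoly A B C D (2 * g + n) (v 0)) := by
  classical
  obtain ⟨k, hk⟩ : ∃ k, k = 2 * g + n := ⟨_, rfl⟩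
  induction k using Nat.strong_induction_on generalizing g n with
  | _ k ih =>
    have h0 : ∀ i, trPoly A B C D 0 i = 0 := fun i => by rw [trPoly]
    have h1 : ∀ i, trPoly A B C D 1 i = 0 := fun i => by
      rw [trPoly]
      simp [h0]
    have h2 : ∀ i, trPoly A B C D 2 i
        = (1 / 2 : ℂ) • ∑ a, ∑ b, A i a b • (X a * X b) + MvPolynomial.C (D i) := fun i => by
      rw [trPoly]
      simp [h1]
    rw [TRF]
    by_cases c1 : g = 0 ∧ n = 2
    · rw [if_pos c1]
      obtain ⟨rfl, rfl⟩ := c1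
      have hu : (Finset.univ : Finset (Fin 2)).val.map (Fin.tail v) = v 1 ::ₘ v 2 ::ₘ 0 := rfl
      rw [hu, ← taylorCoeff_pderiv, ← taylorCoeff_pderiv, Nat.mul_zero, Nat.zero_add, h2,
        taylorCoeff_apply, iterPderiv_zero]
      simp [pderiv_X, Pi.single_apply, Finset.sum_add_distrib, hA _ (v 2) (v 1)]
      ring
    rw [if_neg c1]
    by_cases c2 : g = 1 ∧ n = 0
    · rw [if_pos c2]
      obtain ⟨rfl, rfl⟩ := c2
      have hu : (Finset.univ : Finset (Fin 0)).val.map (Fin.tail v) = 0 := rfl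
      have hD : trPoly A B C D (2 * 1 + 0) (v 0) = _ := h2 (v 0)
      rw [hu, hD, taylorCoeff_apply, iterPderiv_zero]
      simp
    rw [if_neg c2]
    by_cases c3 : 2 * g + n < 3
    · rw [if_pos c3]
      have : 2 * g + n = 0 ∨ 2 * g + n = 1 := by omega
      rcases this with h | h <;> simp [h, h0, h1]
    · rw [if_neg c3]
      obtain ⟨k, rfl⟩ : ∃ k', k = k' + 1 := ⟨k - 1, by omega⟩
      have hk1 : k ≠ 1 := by omega
      have ihS : ∀ (g' : ℕ) (S : Finset (Fin n)) (a : I), 2 * g' + S.card < k + 1 →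
          TRF A B C D g' (S.card + 1)
            (Fin.cons a fun j => Fin.tail v ((S.orderIsoOfFin rfl) j).1)
          = taylorCoeff (S.val.map (Fin.tail v)) (trPoly A B C D (2 * g' + S.card) a) := by
        intro g' S a hlt
        rw [ih _ hlt g' S.card _ rfl, Fin.tail_cons, Fin.cons_zero, val_map_univ_orderIsoOfFin]
      rw [← hk, taylorCoeff_trPoly_succ _ hk1]
      simp only [finsum_eq_sum_of_fintype]
      congr 1
      · refine Finset.sum_congr rfl fun m _ => Finset.sum_congr rfl fun a _ => ?_
        have hm : ({m}ᶜ : Finset (Fin n)) = Finset.univ.erase m := by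
          ext; simp
        have hc : ({m}ᶜ : Finset (Fin n)).card + 1 = n := by
          have := m.isLt
          rw [Finset.card_compl, Finset.card_singleton, Fintype.card_fin]
          omega
        have hk' : 2 * g + ({m}ᶜ : Finset (Fin n)).card = k := by omega
        rw [ihS _ _ _ (by omega), hk', hm]
        rfl
      · congr 1
        refine Finset.sum_congr rfl fun a _ => Finset.sum_congr rfl fun b _ => ?_
        congr 2
        · split_ifs with hg
          · by_contra hne
            obtain ⟨h, hh⟩ := trPoly_mem_genusSubmodule A B C D _ _ _ (Ne.symm hne)
            simp at hh
            omega
          · rw [ih k (by omega) (g - 1) (n + 1) _ (by omega)]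
            have hk' : 2 * (g - 1) + (n + 1) = k := by omega
            have hu : Finset.univ.val.map (Fin.tail
                  (Fin.cons a (Fin.cons b (Fin.tail v)) : Fin (n + 2) → I))
                = b ::ₘ Finset.univ.val.map (Fin.tail v) := by
              rw [Fin.tail_cons, Fin.univ_succ, Finset.cons_val, Multiset.map_cons, Fin.cons_zero,
                Finset.map_val, Multiset.map_map]
              rfl
            rw [hu, hk', Fin.cons_zero, ← taylorCoeff_pderiv, ← taylorCoeff_pderiv, hsymm]
        · rw [Finset.sum_comm, hk]
          refine Finset.sum_congr rfl fun S _ => ?_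
          rw [sum_antidiagonal_taylorCoeff, ← Finset.sum_attach (Finset.range (g + 1))]
          refine Finset.sum_congr rfl fun h' _ => ?_
          have hc := S.card_add_card_compl
          rw [Fintype.card_fin] at hc
          have hh := Finset.mem_range.1 h'.2
          split_ifs with hS
          · rcases hS with hS | hS <;> rw [hS, h0] <;> simp
          · rw [ihS _ _ _ (by omega), ihS _ _ _ (by omega)]

theorem taylorCoeff_trPoly_of_cons_eq
    (hsymm : ∀ k i j, pderiv j (trPoly A B C D k i) = pderiv i (trPoly A B C D k j))
    (k : ℕ) {i j : I} {s t : Multiset I} (h : i ::ₘ s = j ::ₘ t) :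
    taylorCoeff s (trPoly A B C D k i) = taylorCoeff t (trPoly A B C D k j) := by
  rcases Multiset.cons_eq_cons.1 h with ⟨rfl, rfl⟩ | ⟨-, u, rfl, rfl⟩
  · rfl
  · rw [← taylorCoeff_pderiv, ← taylorCoeff_pderiv, hsymm]

end Amplitudes

/-- If the tensors `(A,B,C,D)` of a quantum Airy structure satisfy the relations
(SymA), (BB-AC), (BC), (BA) and (D), then for every `g, n` with `2g-2+n > 0` the
topological recursion amplitude `F_{g,n}` is symmetric under every permutation of its
arguments. -/
theorem stmt1 {I : Type*} [Fintype I] [DecidableEq I]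
    (A B C : I → I → I → ℂ) (D : I → ℂ)
    (hA : ∀ i j k, A i j k = A i k j) (hC : ∀ i j k, C i j k = C i k j)
    (hSymA : ∀ i j k, A i j k = A j i k)
    (h1 : RelBBAC A B C) (h2 : RelBC B C) (h3 : RelBA A B) (h4 : RelD A B C D) :
    ∀ (g n : ℕ), 1 ≤ n → 2 < 2 * g + n →
      ∀ (v : Fin n → I) (σ : Equiv.Perm (Fin n)),
        TRF A B C D g n (v ∘ σ) = TRF A B C D g n v := by
  intro g n hn _ v σ
  obtain ⟨n, rfl⟩ : ∃ m, n = m + 1 := ⟨n - 1, by omega⟩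
  have hsymm := pderiv_trPoly_symm hA hC hSymA h1 h2 h3 h4
  rw [TRF_eq_taylorCoeff hA hsymm, TRF_eq_taylorCoeff hA hsymm]
  have hv : ∀ u : Fin (n + 1) → I,
      u 0 ::ₘ Finset.univ.val.map (Fin.tail u) = Finset.univ.val.map u := fun u => by
    rw [Fin.univ_succ, Finset.cons_val, Multiset.map_cons, Finset.map_val, Multiset.map_map]
    rfl
  refine taylorCoeff_trPoly_of_cons_eq hsymm _ ?_
  rw [hv, hv, ← Multiset.map_map]
  exact congrArg (Multiset.map v) (Multiset.map_univ_val_equiv σ)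
end

section
/- Let I be a finite index set, let A^i_{j,k}, B^i_{j,k}, D^i be complex scalars with A^i_{j,k} = A^i_{k,j}, and suppose C^i_{j,k} = 0 for all i,j,k. For j,k ∈ I define the I×I matrix 𝐁_j by (𝐁_j)_{a,b} := B^a_{j,b}, the vector 𝐀_{j,k} ∈ ℂ^I by (𝐀_{j,k})_a := A^a_{j,k}, and 𝐃 ∈ ℂ^I by 𝐃_a := D^a. Then the topological recursion amplitudes satisfy: (i) for every n ≥ 3 and i_1,…,i_n ∈ I, F_{0,n}(i_1,…,i_n) = Σ_{2 ≤ m < m' ≤ n} Σ_σ ( 𝐁_{i_{σ(1)}} 𝐁_{i_{σ(2)}} ⋯ 𝐁_{i_{σ(n−3)}} · 𝐀_{i_m, i_{m'}} )_{i_1}, where σ ranges over all bijections from {1,…,n−3} to {2,…,n} \ {m, m'}; (ii) for every n ≥ 1, F_{1,n}(i_1,…,i_n) = Σ_σ ( 𝐁_{i_{σ(1)}} ⋯ 𝐁_{i_{σ(n−1)}} · 𝐃 )_{i_1}, where σ ranges over all bijections from {1,…,n−1} to {2,…,n}; (iii) F_{g,n}(i_1,…,i_n) = 0 for every g ≥ 2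 and n ≥ 1. -/
open Finset

/-- The matrix `𝐁_j` with entries `(𝐁_j)_{a,b} = B^a_{j,b}`. -/
def Bmat {I : Type*} (B : I → I → I → ℂ) (j : I) : Matrix I I ℂ :=
  Matrix.of fun a b => B a j b

/-- The vector `𝐀_{j,k}` with components `(𝐀_{j,k})_a = A^a_{j,k}`. -/
def Avec {I : Type*} (A : I → I → I → ℂ) (j k : I) : I → ℂ :=
  fun a => A a j k

/-- Sum over the ways to split the entries of `w` into an increasing `r`-tuple, inserted into `E`,
and an ordered `k`-tuple without repetitions disjoint from it, indexing a chain of matrices `𝐁`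
applied to the vector `E`. -/
noncomputable def chainSum {I : Type*} [Fintype I] [DecidableEq I] (B : I → I → I → ℂ)
    {r : ℕ} (E : (Fin r → I) → I → ℂ) (n k : ℕ) (w : Fin n → I) : I → ℂ :=
  open Classical in
  ∑ q : Fin r → Fin n, ∑ f : Fin k → Fin n,
    if StrictMono q ∧ Function.Injective f ∧ ∀ t s, f t ≠ q s then
      (List.ofFn fun t => Bmat B (w (f t))).prod.mulVec (E (w ∘ q))
    else 0

theorem sum_comp_succAbove {M : Type*} [AddCommMonoid M] {r n : ℕ} (x : Fin (n + 1))
    (P : (Fin r → Fin (n + 1)) → M) (hP : ∀ q, (∃ s, q s = x) → P q = 0) :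
    ∑ q, P q = ∑ q : Fin r → Fin n, P (x.succAbove ∘ q) := by
  symm
  refine Finset.sum_of_injOn (fun q => x.succAbove ∘ q)
    (fun a _ b _ h => (Fin.succAbove_right_injective (p := x)).comp_left h)
    (fun _ _ => by simp) (fun q _ hq => hP q ?_) (fun _ _ => rfl)
  by_contra! h
  choose q' hq' using fun s => Fin.exists_succAbove_eq (h s)
  exact hq ⟨q', by simp, funext hq'⟩

theorem chainSum_succ {I : Type*} [Fintype I] [DecidableEq I] (B : I → I → I → ℂ)
    {r : ℕ} (E : (Fin r → I) → I → ℂ) (n k : ℕ) (w : Fin (n + 1) → I) :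
    chainSum B E (n + 1) (k + 1) w =
      ∑ x, (Bmat B (w x)).mulVec (chainSum B E n k (w ∘ x.succAbove)) := by
  classical
  have hsplit (P : (Fin (k + 1) → Fin (n + 1)) → I → ℂ) :
      ∑ f, P f = ∑ x, ∑ f : Fin k → Fin (n + 1), P (Fin.cons x f) := by
    rw [← Fintype.sum_prod_type', ← (Fin.consEquiv fun _ => Fin (n + 1)).sum_comp]
    rfl
  simp only [chainSum]
  rw [Finset.sum_congr rfl fun q _ => hsplit _, Finset.sum_comm]
  refine Finset.sum_congr rfl fun x _ => ?_
  rw [sum_comp_succAbove x]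
  · rw [Matrix.mulVec_sum]
    refine Finset.sum_congr rfl fun q _ => ?_
    rw [sum_comp_succAbove x]
    · rw [Matrix.mulVec_sum]
      refine Finset.sum_congr rfl fun f _ => ?_
      have hiff : (StrictMono (x.succAbove ∘ q) ∧
          Function.Injective (Fin.cons x (x.succAbove ∘ f) : Fin (k + 1) → Fin (n + 1)) ∧
          ∀ t s, (Fin.cons x (x.succAbove ∘ f) : Fin (k + 1) → Fin (n + 1)) t ≠
            (x.succAbove ∘ q) s) ↔
          StrictMono q ∧ Function.Injective f ∧ ∀ t s, f t ≠ q s := by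
        have hinj := Fin.succAbove_right_injective (p := x)
        rw [Fin.cons_injective_iff, hinj.of_comp_iff]
        simp [Fin.forall_fin_succ, StrictMono, hinj.eq_iff, Fin.succAbove_ne, Fin.ne_succAbove]
      simp only [hiff]
      split_ifs
      · simp [List.ofFn_succ, Matrix.mulVec_mulVec, Function.comp_def]
      · simp
    · rintro f ⟨t, rfl⟩
      rw [if_neg]
      rintro ⟨-, h, -⟩
      exact (Fin.cons_injective_iff.1 h).1 ⟨t, rfl⟩
  · rintro q ⟨s, rfl⟩
    refine Finset.sum_eq_zero fun f _ => if_neg ?_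
    rintro ⟨-, -, h⟩
    exact h 0 s (by simp)

theorem chainSum_zero {I : Type*} [Fintype I] [DecidableEq I] (B : I → I → I → ℂ)
    {r : ℕ} (E : (Fin r → I) → I → ℂ) (w : Fin r → I) :
    chainSum B E r 0 w = E w := by
  classical
  have h (q : Fin r → Fin r) : StrictMono q ↔ q = id := by
    exact ⟨fun hq => hq.eq_id, fun hq => hq ▸ strictMono_id⟩
  simp [chainSum, h, Function.injective_of_subsingleton]

theorem TRF_comp_cast {ι : Type*} (A B C : ι → ι → ι → ℂ) (D : ι → ℂ) (g : ℕ) {n n' : ℕ}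
    (h : n = n') (v : Fin n' → ι) : TRF A B C D g n (v ∘ Fin.cast h) = TRF A B C D g n' v := by
  subst h
  rfl

theorem TRF_succ {I : Type*} [Fintype I] (A B C : I → I → I → ℂ) (D : I → ℂ)
    (hC : ∀ i j k, C i j k = 0) (g n : ℕ) (hn : 3 < 2 * g + n + 2) (w : Fin (n + 1) → I) (i : I) :
    TRF A B C D g (n + 2) (Fin.cons i w) =
      ∑ m, ((Bmat B (w m)).mulVec
        fun a => TRF A B C D g (n + 1) (Fin.cons a (w ∘ m.succAbove))) i := by
  rw [TRF, if_neg (by omega), if_neg (by omega), if_neg (by omega)]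
  simp only [hC, zero_mul, finsum_zero, mul_zero, add_zero]
  simp only [finsum_eq_sum_of_fintype]
  refine Finset.sum_congr rfl fun m _ => Finset.sum_congr rfl fun a _ => ?_
  have hcard : ({m}ᶜ : Finset (Fin (n + 1))).card = n := by simp [Finset.card_compl]
  simp only [Bmat, Matrix.of_apply, Fin.cons_zero, Fin.cons_succ, Fin.tail_cons]
  rw [← TRF_comp_cast A B C D g (congrArg (· + 1) hcard)]
  congr 2
  funext j
  refine Fin.cases ?_ (fun j => ?_) j
  · rfl
  · have := Finset.orderEmbOfFin_unique (s := ({m}ᶜ : Finset (Fin (n + 1)))) rfl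
      (f := fun j => m.succAbove (Fin.cast hcard j)) (fun x => by simp [Fin.succAbove_ne])
      (fun a b hab => (Fin.strictMono_succAbove m) hab)
    exact congrArg w (congrFun this j).symm

theorem TRF_eq_chainSum {I : Type*} [Fintype I] [DecidableEq I] (A B C : I → I → I → ℂ)
    (D : I → ℂ) (hC : ∀ i j k, C i j k = 0) (g r : ℕ) (hr : 2 * g + r = 2)
    (E : (Fin r → I) → I → ℂ)
    (hE : ∀ i w, TRF A B C D g (r + 1) (Fin.cons i w) = E w i) (n k : ℕ) (hn : n = r + k)
    (w : Fin n → I) (i : I) :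
    TRF A B C D g (n + 1) (Fin.cons i w) = chainSum B E n k w i := by
  subst hn
  induction k generalizing i with
  | zero => exact (hE i w).trans (congrFun (chainSum_zero B E w) i).symm
  | succ k ih =>
    refine (TRF_succ A B C D hC g (r + k) (by omega) w i).trans ?_
    simp_rw [ih]
    exact ((congrFun (chainSum_succ B E (r + k) k w) i).trans (Finset.sum_apply _ _ _)).symm

theorem TRF_eq_zero {I : Type*} [Fintype I] (A B C : I → I → I → ℂ) (D : I → ℂ)
    (hC : ∀ i j k, C i j k = 0) (g : ℕ) (hg : 2 ≤ g) (n : ℕ) (v : Fin (n + 1) → I) :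
    TRF A B C D g (n + 1) v = 0 := by
  induction n with
  | zero =>
    rw [TRF, if_neg (by omega), if_neg (by omega), if_neg (by omega)]
    simp [hC]
  | succ n ih =>
    rw [← Fin.cons_self_tail v, TRF_succ A B C D hC g n (by omega)]
    simp [ih, Matrix.mulVec, dotProduct]

theorem sum_equiv_eq_sum_injective {α β M : Type*} [Fintype β] [DecidableEq α] [AddCommMonoid M]
    {k : ℕ} (s : Finset α) (hs : s.card = k) (e : β → α) (he : Function.Injective e)
    (hse : ∀ x ∈ s, ∃ y, e y = x) (T : (Fin k → α) → M) :
    open Classical in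
    ∑ σ : Fin k ≃ {x // x ∈ s}, T (fun t => (σ t).1) =
      ∑ f : Fin k → β, if Function.Injective f ∧ ∀ t, e (f t) ∈ s then T (e ∘ f) else 0 := by
  classical
  choose u hu using hse
  refine Finset.sum_of_injOn (fun σ t => u (σ t).1 (σ t).2) ?_ (fun _ _ => by simp) ?_ ?_
  · intro σ _ τ _ h
    ext t
    rw [← hu _ (σ t).2, ← hu _ (τ t).2]
    exact congrArg e (congrFun h t)
  · intro f _ hf
    refine if_neg fun ⟨hinj, hmem⟩ => hf ?_
    have hb : Function.Bijective fun t => (⟨e (f t), hmem t⟩ : {x // x ∈ s}) :=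
      (Fintype.bijective_iff_injective_and_card _).2
        ⟨fun a b h => hinj (he (congrArg Subtype.val h)), by simp [hs]⟩
    exact ⟨Equiv.ofBijective _ hb, by simp, funext fun t => he (hu _ _)⟩
  · intro σ _
    rw [if_pos]
    · exact congrArg T (funext fun t => (hu _ _).symm)
    · refine ⟨fun a b h => σ.injective (Subtype.ext ?_), fun t => by rw [hu]; exact (σ t).2⟩
      rw [← hu _ (σ a).2, ← hu _ (σ b).2]
      exact congrArg e h


/-- Explicit formula for the partition function of a quantum Airy structure with `C = 0`:
only genus `0` and `1` amplitudes are nonzero, and they are given by sums over chains of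
the matrices `𝐁` applied to the vectors `𝐀_{m,m'}` (genus 0) resp. `𝐃` (genus 1). -/
theorem stmt6 {I : Type*} [Fintype I] [DecidableEq I]
    (A B C : I → I → I → ℂ) (D : I → ℂ)
    (hA : ∀ i j k, A i j k = A i k j)
    (hC : ∀ i j k, C i j k = 0) :
    (∀ n : ℕ, ∀ hn : 3 ≤ n, ∀ v : Fin n → I,
      TRF A B C D 0 n v =
        ∑ m : Fin n, ∑ m' : Fin n,
          if 0 < m.1 ∧ m < m' then
            ∑ σ : Fin (n - 3) ≃
                {x : Fin n // x ∈ (({⟨0, by omega⟩, m, m'} : Finset (Fin n))ᶜ : Finset (Fin n))},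
              ((List.ofFn fun t : Fin (n - 3) => Bmat B (v (σ t).1)).prod.mulVec
                (Avec A (v m) (v m'))) (v ⟨0, by omega⟩)
          else 0)
    ∧ (∀ n : ℕ, ∀ hn : 1 ≤ n, ∀ v : Fin n → I,
      TRF A B C D 1 n v =
        ∑ σ : Fin (n - 1) ≃
            {x : Fin n // x ∈ (({⟨0, by omega⟩} : Finset (Fin n))ᶜ : Finset (Fin n))},
          ((List.ofFn fun t : Fin (n - 1) => Bmat B (v (σ t).1)).prod.mulVec D)
            (v ⟨0, by omega⟩))
    ∧ (∀ g n : ℕ, 2 ≤ g → 1 ≤ n → ∀ v : Fin n → I, TRF A B C D g n v = 0) := by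
  classical
  refine ⟨fun n hn v => ?_, fun n hn v => ?_, fun g n hg hn v => ?_⟩
  · obtain ⟨k, rfl⟩ := Nat.exists_eq_add_of_le' hn
    have h := TRF_eq_chainSum A B C D hC 0 2 rfl (fun w => Avec A (w 0) (w 1))
      (fun i w => by rw [TRF]; rfl) (k + 2) k (add_comm _ _) (Fin.tail v) (v 0)
    rw [Fin.cons_self_tail] at h
    refine h.trans ?_
    rw [chainSum, Finset.sum_apply, ← (finTwoArrowEquiv (Fin (k + 2))).symm.sum_comp,
      Fintype.sum_prod_type]
    refine Eq.trans ?_ (Fin.sum_univ_succ _).symm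
    rw [Finset.sum_eq_zero fun _ _ => if_neg fun h => absurd h.1 (lt_irrefl 0), zero_add]
    refine Finset.sum_congr rfl fun m _ => ?_
    refine Eq.trans ?_ (Fin.sum_univ_succ _).symm
    rw [if_neg fun h => Fin.not_lt_zero _ h.2, zero_add]
    refine Finset.sum_congr rfl fun m' _ => ?_
    have hq : StrictMono ((finTwoArrowEquiv (Fin (k + 2))).symm (m, m')) ↔ m < m' := by
      simp [Fin.strictMono_iff_lt_succ]
    by_cases hm : m < m'
    · rw [if_pos ⟨Nat.succ_pos _, Fin.succ_lt_succ_iff.2 hm⟩]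
      have hs := sum_equiv_eq_sum_injective
        (({0, m.succ, m'.succ} : Finset (Fin (k + 3)))ᶜ) (k := k)
        (by rw [Finset.card_compl, Finset.card_eq_three.2
              ⟨_, _, _, (Fin.succ_ne_zero m).symm, (Fin.succ_ne_zero m').symm,
                fun h => hm.ne (Fin.succ_injective _ h), rfl⟩]
            simp)
        Fin.succ (Fin.succ_injective _)
        (fun x hx => Fin.exists_succ_eq.2 fun h => by simp [h] at hx)
        (fun f => ((List.ofFn fun t => Bmat B (v (f t))).prod.mulVec
          (Avec A (v m.succ) (v m'.succ))) (v 0))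
      refine Eq.trans ?_ hs.symm
      rw [Finset.sum_apply]
      refine Finset.sum_congr rfl fun f _ => ?_
      simp only [hq, hm, true_and]
      simp [Fin.forall_fin_two, ite_apply, Fin.tail]
    · rw [if_neg fun h => hm (Fin.succ_lt_succ_iff.1 h.2)]
      simp [hm]
  · obtain ⟨k, rfl⟩ := Nat.exists_eq_add_of_le' hn
    have h := TRF_eq_chainSum A B C D hC 1 0 rfl (fun _ => D)
      (fun i w => by rw [TRF]; simp) k k (zero_add k).symm (Fin.tail v) (v 0)
    rw [Fin.cons_self_tail] at h
    refine h.trans ?_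
    have hs := sum_equiv_eq_sum_injective (({0} : Finset (Fin (k + 1)))ᶜ) (k := k)
      (by simp [Finset.card_compl]) Fin.succ (Fin.succ_injective _)
      (fun x hx => Fin.exists_succ_eq.2 fun h => by simp [h] at hx)
      (fun f => ((List.ofFn fun t => Bmat B (v (f t))).prod.mulVec D) (v 0))
    refine Eq.trans ?_ hs.symm
    rw [chainSum, Fintype.sum_unique, Finset.sum_apply]
    refine Finset.sum_congr rfl fun f _ => ?_
    simp [ite_apply, Fin.tail, Subsingleton.strictMono]
  · obtain ⟨k, rfl⟩ := Nat.exists_eq_add_of_le' hn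
    exact TRF_eq_zero A B C D hC g hg k v
end

section
/- Let L be a finite-dimensional complex Lie algebra and W a finite-dimensional L-module equipped with an L-invariant nondegenerate alternating bilinear form ω, where L-invariance means ω(x • w₁, w₂) + ω(w₁, x • w₂) = 0 for all x ∈ L and w₁, w₂ ∈ W (here • denotes the Lie module action). Suppose W is an internal direct sum W = ⊕_{i∈ι} W_i of irreducible L-submodules. Let M be a finite-dimensional irreducible L-module that admits a nonzero L-invariant symmetric bilinear form and admits no nonzero L-invariant alternating bilinear form. Then the number of indices i ∈ ι such that W_i is isomorphic to M as an L-module is even. -/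
/-- A nonzero invariant bilinear form on an irreducible Lie module has trivial left radical. -/
theorem LieModule.IsIrreducible.injective_of_invariant {K L M : Type*} [Field K] [LieRing L]
    [AddCommGroup M] [Module K M] [LieRingModule L M] (hM : LieModule.IsIrreducible K L M)
    {β : M →ₗ[K] M →ₗ[K] K} (hβ0 : β ≠ 0)
    (hβ : ∀ (x : L) (m₁ m₂ : M), β ⁅x, m₁⁆ m₂ + β m₁ ⁅x, m₂⁆ = 0) :
    Function.Injective β := by
  let R : LieSubmodule K L M :=
    { LinearMap.ker β with
      lie_mem := fun {x m} hm => by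
        have hm : β m = 0 := hm
        refine LinearMap.ext fun m' => ?_
        simpa [hm] using hβ x m m' }
  rcases hM.eq_bot_or_eq_top R with h | h
  · refine LinearMap.ker_eq_bot.mp ((Submodule.eq_bot_iff _).mpr fun m hm => ?_)
    have : m ∈ R := hm
    rwa [h, LieSubmodule.mem_bot] at this
  · refine absurd (LinearMap.ext fun m => ?_) hβ0
    have : m ∈ R := h ▸ LieSubmodule.mem_top m
    exact this

/-- An injective invariant form on `M` represents every invariant pairing of `M` with another
Lie module `N` by a morphism `N → M`. -/
theorem LieModuleHom.exists_eq_of_invariant {K L M N : Type*} [Field K] [LieRing L]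
    [AddCommGroup M] [Module K M] [LieRingModule L M] [FiniteDimensional K M]
    [AddCommGroup N] [Module K N] [LieRingModule L N]
    {β : M →ₗ[K] M →ₗ[K] K} (hinj : Function.Injective β)
    (hβ : ∀ (x : L) (m₁ m₂ : M), β ⁅x, m₁⁆ m₂ + β m₁ ⁅x, m₂⁆ = 0)
    {γ : M →ₗ[K] N →ₗ[K] K}
    (hγ : ∀ (x : L) (m : M) (n : N), γ ⁅x, m⁆ n + γ m ⁅x, n⁆ = 0) :
    ∃ f : N →ₗ⁅K,L⁆ M, ∀ m n, γ m n = β (f n) m := by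
  let e : M ≃ₗ[K] Module.Dual K M :=
    LinearEquiv.ofInjectiveOfFinrankEq β hinj Subspace.dual_finrank_eq.symm
  let g : N →ₗ[K] M := e.symm.toLinearMap ∘ₗ γ.flip
  have hg : ∀ m n, β (g n) m = γ m n := fun m n =>
    LinearMap.congr_fun (e.apply_symm_apply (γ.flip n)) m
  refine ⟨{ g with map_lie' := fun {x n} => hinj (LinearMap.ext fun m => ?_) },
    fun m n => (hg m n).symm⟩
  change β (g ⁅x, n⁆) m = β ⁅x, g n⁆ m
  have h₁ := hγ x m n
  have h₂ := hβ x (g n) m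
  rw [hg] at h₂ ⊢
  linear_combination h₁ - h₂

/-- Schur's lemma: a nonzero morphism of irreducible Lie modules is bijective. -/
theorem LieModuleHom.bijective_of_ne_zero {K L M N : Type*} [CommRing K] [LieRing L]
    [AddCommGroup M] [Module K M] [LieRingModule L M]
    [AddCommGroup N] [Module K N] [LieRingModule L N]
    (hN : LieModule.IsIrreducible K L N) (hM : LieModule.IsIrreducible K L M)
    {f : N →ₗ⁅K,L⁆ M} (hf : f ≠ 0) : Function.Bijective f := by
  constructor
  · rw [← LieModuleHom.ker_eq_bot]
    refine (hN.eq_bot_or_eq_top f.ker).resolve_right fun h => hf ?_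
    ext n
    exact LieModuleHom.mem_ker.mp (h ▸ LieSubmodule.mem_top n)
  · rw [← LieModuleHom.range_eq_top]
    refine (hM.eq_bot_or_eq_top f.range).resolve_left fun h => hf ?_
    ext n
    have : f n ∈ f.range := (LieModuleHom.mem_range f _).mpr ⟨n, rfl⟩
    rwa [h, LieSubmodule.mem_bot] at this

/-- Schur's lemma: over an algebraically closed field, an endomorphism of a finite-dimensional
irreducible Lie module is a scalar. -/
theorem LieModuleHom.exists_eq_smul {K L M : Type*} [Field K] [IsAlgClosed K] [LieRing L]
    [LieAlgebra K L] [AddCommGroup M] [Module K M] [LieRingModule L M] [LieModule K L M]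
    [FiniteDimensional K M] (hM : LieModule.IsIrreducible K L M) (f : M →ₗ⁅K,L⁆ M) :
    ∃ c : K, ∀ m, f m = c • m := by
  have := LieModule.nontrivial_of_isIrreducible K L M
  obtain ⟨c, hc⟩ := Module.End.exists_eigenvalue (f : M →ₗ[K] M)
  obtain ⟨v, hv⟩ := hc.exists_hasEigenvector
  have hzero : f - c • LieModuleHom.id = 0 := by
    by_contra h
    refine hv.2 ((LieModuleHom.bijective_of_ne_zero hM hM h).1 ?_)
    have : f v = c • v := hv.apply_eq_smul
    simp [this]
  refine ⟨c, fun m => ?_⟩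
  simpa [sub_eq_zero] using LieModuleHom.congr_fun hzero m

/-- A skew-symmetric matrix of odd size over a field of characteristic zero is singular. -/
theorem Matrix.det_eq_zero_of_transpose_eq_neg {K n : Type*} [Field K] [CharZero K] [Fintype n]
    [DecidableEq n] {A : Matrix n n K} (hA : A.transpose = -A) (hn : Odd (Fintype.card n)) :
    A.det = 0 := by
  have h := A.det_transpose
  rw [hA, Matrix.det_neg, hn.neg_one_pow, neg_one_mul] at h
  exact self_eq_neg.mp h.symm


/-- Let `L` be a finite-dimensional complex Lie algebra and `W` a finite-dimensional
`L`-module carrying an `L`-invariant nondegenerate alternating bilinear form `ω`, and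
suppose `W` is the internal direct sum of irreducible `L`-submodules `(Wi i)_{i ∈ ι}`.
If `M` is a finite-dimensional irreducible `L`-module admitting a nonzero `L`-invariant
symmetric bilinear form and no nonzero `L`-invariant alternating bilinear form, then the
number of indices `i` with `Wi i ≅ M` is even. -/
theorem stmt19 {L : Type*} [LieRing L] [LieAlgebra ℂ L] [FiniteDimensional ℂ L]
    {W : Type*} [AddCommGroup W] [Module ℂ W] [LieRingModule L W] [LieModule ℂ L W]
    [FiniteDimensional ℂ W]
    (ω : W →ₗ[ℂ] W →ₗ[ℂ] ℂ)
    (halt : ∀ w : W, ω w w = 0)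
    (hnd : ∀ w : W, (∀ w' : W, ω w w' = 0) → w = 0)
    (hinv : ∀ (x : L) (w₁ w₂ : W), ω ⁅x, w₁⁆ w₂ + ω w₁ ⁅x, w₂⁆ = 0)
    {ι : Type*} [Fintype ι] [DecidableEq ι] (Wi : ι → LieSubmodule ℂ L W)
    (hds : DirectSum.IsInternal fun i => (Wi i : Submodule ℂ W))
    (hirr : ∀ i, LieModule.IsIrreducible ℂ L (Wi i))
    {M : Type*} [AddCommGroup M] [Module ℂ M] [LieRingModule L M] [LieModule ℂ L M]
    [FiniteDimensional ℂ M]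
    (hirrM : LieModule.IsIrreducible ℂ L M)
    (β : M →ₗ[ℂ] M →ₗ[ℂ] ℂ) (hβ0 : β ≠ 0)
    (hβsym : ∀ m₁ m₂ : M, β m₁ m₂ = β m₂ m₁)
    (hβinv : ∀ (x : L) (m₁ m₂ : M), β ⁅x, m₁⁆ m₂ + β m₁ ⁅x, m₂⁆ = 0)
    (hnoalt : ∀ γ : M →ₗ[ℂ] M →ₗ[ℂ] ℂ,
        (∀ (x : L) (m₁ m₂ : M), γ ⁅x, m₁⁆ m₂ + γ m₁ ⁅x, m₂⁆ = 0) →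
        (∀ m : M, γ m m = 0) → γ = 0) :
    Even (Nat.card {i : ι // Nonempty ((Wi i) ≃ₗ⁅ℂ,L⁆ M)}) := by
  classical
  have hβinj := hirrM.injective_of_invariant hβ0 hβinv
  have hskew : ∀ w₁ w₂ : W, ω w₁ w₂ = -ω w₂ w₁ := fun w₁ w₂ => by
    have h := halt (w₁ + w₂)
    simp only [map_add, LinearMap.add_apply, halt, zero_add, add_zero] at h
    linear_combination h
  set J := {i : ι // Nonempty ((Wi i) ≃ₗ⁅ℂ,L⁆ M)}
  let e : ∀ i : J, M →ₗ⁅ℂ,L⁆ W := fun i => (Wi i).incl.comp i.2.some.symm.toLieModuleHom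
  have he_mem : ∀ (i : J) m, e i m ∈ Wi i := fun i m => (i.2.some.symm m).2
  have he_inj : ∀ i, Function.Injective (e i) := fun i =>
    Subtype.val_injective.comp i.2.some.symm.injective
  have he_surj : ∀ (i : J) (w : W), w ∈ Wi i → ∃ m, e i m = w := fun i w hw =>
    ⟨i.2.some ⟨w, hw⟩, congrArg Subtype.val (i.2.some.symm_apply_apply ⟨w, hw⟩)⟩
  have hcoeff : ∀ i j : J, ∃ a : ℂ, ∀ m m', ω (e i m) (e j m') = a * β m m' := fun i j => by
    obtain ⟨f, hf⟩ := LieModuleHom.exists_eq_of_invariant hβinj hβinv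
      (γ := ω.compl₁₂ (e i : M →ₗ[ℂ] W) (e j : M →ₗ[ℂ] W))
      (fun x m m' => by simpa using hinv x (e i m) (e j m'))
    obtain ⟨c, hc⟩ := LieModuleHom.exists_eq_smul hirrM f
    refine ⟨c, fun m m' => ?_⟩
    simpa [hc, hβsym m' m] using hf m m'
  choose a ha using hcoeff
  have horth : ∀ (i : J) (j : ι), IsEmpty ((Wi j) ≃ₗ⁅ℂ,L⁆ M) → ∀ m, ∀ w ∈ Wi j,
      ω (e i m) w = 0 := fun i j hj m w hw => by
    obtain ⟨f, hf⟩ := LieModuleHom.exists_eq_of_invariant hβinj hβinv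
      (γ := ω.compl₁₂ (e i : M →ₗ[ℂ] W) ((Wi j).incl : Wi j →ₗ[ℂ] W))
      (fun x m n => by
        change ω (e i ⁅x, m⁆) (n : W) + ω (e i m) ⁅x, (n : W)⁆ = 0
        rw [LieModuleHom.map_lie]
        exact hinv x (e i m) n)
    have hf0 : f = 0 := by
      by_contra h
      have hbij := LieModuleHom.bijective_of_ne_zero (hirr j) hirrM h
      exact hj.false { LinearEquiv.ofBijective (f : Wi j →ₗ[ℂ] M) hbij with
        map_lie' := f.map_lie' }
    have h := hf m ⟨w, hw⟩
    rw [hf0, LieModuleHom.zero_apply, map_zero, LinearMap.zero_apply] at h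
    exact h
  obtain ⟨m₁, m₂, hm⟩ : ∃ m₁ m₂, β m₁ m₂ ≠ 0 := by
    by_contra! h
    exact hβ0 (LinearMap.ext₂ h)
  have ha_skew : (Matrix.of a).transpose = -Matrix.of a := by
    ext i j
    have h := hskew (e j m₁) (e i m₂)
    rw [ha, ha, hβsym m₂ m₁, ← neg_mul] at h
    exact mul_right_cancel₀ hm h
  rw [Nat.card_eq_fintype_card, ← Nat.not_odd_iff_even]
  intro hodd
  obtain ⟨v, hv0, hv⟩ := Matrix.exists_vecMul_eq_zero_iff.mpr
    (Matrix.det_eq_zero_of_transpose_eq_neg ha_skew hodd)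
  have hw0 : ∑ i, v i • e i m₁ = 0 := by
    refine hnd _ fun w' => ?_
    have hw' : w' ∈ ⨆ j, (Wi j : Submodule ℂ W) := hds.submodule_iSup_eq_top ▸ Submodule.mem_top
    induction hw' using Submodule.iSup_induction' with
    | zero => simp
    | add x y _ _ hx hy => rw [map_add, hx, hy, add_zero]
    | mem j w hw =>
      by_cases hj : Nonempty ((Wi j) ≃ₗ⁅ℂ,L⁆ M)
      · obtain ⟨m', rfl⟩ := he_surj ⟨j, hj⟩ w hw
        have h := congrFun hv ⟨j, hj⟩
        simp only [Matrix.vecMul, dotProduct, Matrix.of_apply, Pi.zero_apply] at h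
        simp only [map_sum, map_smul, LinearMap.sum_apply, LinearMap.smul_apply, ha, smul_eq_mul,
          ← mul_assoc, ← Finset.sum_mul, h, zero_mul]
      · simp only [map_sum, map_smul, LinearMap.sum_apply, LinearMap.smul_apply,
          horth _ j (not_nonempty_iff.mp hj) _ w hw, smul_zero, Finset.sum_const_zero]
  have hm₁ : m₁ ≠ 0 := by
    rintro rfl
    simp at hm
  have hlin : LinearIndependent ℂ fun i : J => e i m₁ :=
    (hds.submodule_iSupIndep.comp Subtype.val_injective).linearIndependent _ (he_mem · m₁)
      fun i h => hm₁ (he_inj i (h.trans (map_zero (e i)).symm))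
  exact hv0 (funext (Fintype.linearIndependent_iff.mp hlin v hw0))
end
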